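/- Let n ≥ 2, let z_1, …, z_n ∈ ℂ be distinct, let m_1, …, m_n > 0, let γ ∈ ℂ with γ ≠ 0, and let η(z) = z − γ·conj(z) − Σ_{j=1}^n m_j/(conj(z) − conj(z_j)) on ℂ \ {z_1, …, z_n}. Then for every ζ ∈ ℂ, the set of images {z ∈ ℂ \ {z_1, …, z_n} : η(z) = ζ} is finite and has at most 5n elements. -/

import Mathlib

section
open Set Filter Topology Metric Complex
namespace KN

/-- the domain: complement of the poles -/
def Om {n : ℕ} (z : Fin n → ℂ) : Set ℂ := {x | ∀ j, x ≠ z j}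

/-- the rational function -/
noncomputable def rr {n : ℕ} (z : Fin n → ℂ) (m : Fin n → ℝ) (g c : ℂ) (x : ℂ) : ℂ :=
  c + g * x + ∑ j, (m j : ℂ) / (x - z j)

/-- its derivative -/
noncomputable def dr {n : ℕ} (z : Fin n → ℂ) (m : Fin n → ℝ) (g : ℂ) (x : ℂ) : ℂ :=
  g - ∑ j, (m j : ℂ) / (x - z j) ^ 2

theorem isOpen_Om {n : ℕ} (z : Fin n → ℂ) : IsOpen (Om z) := by
  have : Om z = ⋂ j, {z j}ᶜ := by ext x; simp [Om]
  rw [this]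
  exact isOpen_iInter_of_finite fun j => isOpen_compl_singleton

theorem hasStrictDerivAt_rr {n : ℕ} (z : Fin n → ℂ) (m : Fin n → ℝ) (g c : ℂ) {x : ℂ}
    (hx : x ∈ Om z) : HasStrictDerivAt (rr z m g c) (dr z m g x) x := by
  have h1 : HasStrictDerivAt (fun x => c + g * x) g x := by
    simpa using ((hasStrictDerivAt_id x).const_mul g).const_add c
  have h2 : HasStrictDerivAt (fun x => ∑ j, (m j : ℂ) / (x - z j))
      (∑ j, -((m j : ℂ) / (x - z j) ^ 2)) x := by
    refine HasStrictDerivAt.fun_sum fun j _ => ?_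
    have h0 : HasStrictDerivAt (fun y : ℂ => y - z j) 1 x := (hasStrictDerivAt_id x).sub_const (z j)
    have h : HasStrictDerivAt (fun y : ℂ => (y - z j)⁻¹) (-((x - z j) ^ 2)⁻¹ * 1) x :=
      (hasStrictDerivAt_inv (sub_ne_zero.2 (hx j))).comp x h0
    have h' := h.const_mul (m j : ℂ)
    simp only [div_eq_mul_inv]
    exact h'.congr_deriv (by ring)
  have := h1.add h2
  exact this.congr_deriv (by simp only [dr, sub_eq_add_neg, Finset.sum_neg_distrib])

theorem differentiableOn_rr {n : ℕ} (z : Fin n → ℂ) (m : Fin n → ℝ) (g c : ℂ) :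
    DifferentiableOn ℂ (rr z m g c) (Om z) := fun _ hx =>
  (hasStrictDerivAt_rr z m g c hx).hasDerivAt.differentiableAt.differentiableWithinAt

theorem continuousOn_dr {n : ℕ} (z : Fin n → ℂ) (m : Fin n → ℝ) (g : ℂ) :
    ContinuousOn (dr z m g) (Om z) := by
  unfold dr
  refine continuousOn_const.sub (continuousOn_finsetSum _ fun j _ => ?_)
  refine continuousOn_const.div (by fun_prop) fun x hx => ?_
  exact pow_ne_zero _ (sub_ne_zero.2 (hx j))

/-- properness from blow-up at the poles and at infinity -/
theorem isCompact_preim {n : ℕ} (z : Fin n → ℂ) (F : ℂ → ℂ) (hF : ContinuousOn F (Om z))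
    (hp : ∀ j, Tendsto (fun x => ‖F x‖) (𝓝[≠] (z j)) atTop)
    (hi : Tendsto (fun x => ‖F x‖) (cocompact ℂ) atTop) {K : Set ℂ} (hK : IsCompact K) :
    IsCompact {x | x ∈ Om z ∧ F x ∈ K} := by
  obtain ⟨C, hC⟩ := hK.isBounded.exists_norm_le
  refine Metric.isCompact_of_isClosed_isBounded ?_ ?_
  · rw [← isOpen_compl_iff, isOpen_iff_mem_nhds]
    intro x hx
    by_cases hxO : x ∈ Om z
    · have h1 : F x ∈ Kᶜ := fun h => hx ⟨hxO, h⟩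
      have h2 : ContinuousAt F x := hF.continuousAt ((isOpen_Om z).mem_nhds hxO)
      filter_upwards [h2 (hK.isClosed.isOpen_compl.mem_nhds h1)] with y hy h3
      exact hy h3.2
    · simp only [Om, mem_ofPred_eq, not_forall, not_not] at hxO
      obtain ⟨j, rfl⟩ := hxO
      have := (hp j).eventually (eventually_gt_atTop C)
      rw [eventually_nhdsWithin_iff] at this
      filter_upwards [this] with y hy h3
      have := hy (h3.1 j)
      exact absurd (hC _ h3.2) (not_le.2 this)
  · have := hi.eventually (eventually_gt_atTop C)
    have h2 : {x | x ∈ Om z ∧ F x ∈ K}ᶜ ∈ cocompact ℂ := by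
      filter_upwards [this] with y hy h3
      exact absurd (hC _ h3.2) (not_le.2 hy)
    rw [← Metric.cobounded_eq_cocompact] at h2
    simpa using Bornology.isBounded_def.2 h2

theorem tendsto_sum_cocompact {n : ℕ} (z : Fin n → ℂ) (m : Fin n → ℝ) :
    Tendsto (fun x => ∑ j, (m j : ℂ) / (x - z j)) (cocompact ℂ) (𝓝 0) := by
  have : (0 : ℂ) = ∑ j : Fin n, 0 := by simp
  rw [this]
  refine tendsto_finsetSum _ fun j _ => ?_
  have h1 : Tendsto (fun x : ℂ => x - z j) (cocompact ℂ) (cocompact ℂ) := by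
    simpa [sub_eq_add_neg] using (Homeomorph.addRight (-(z j))).isClosedEmbedding.tendsto_cocompact
  have h2 : Tendsto (fun x : ℂ => (x - z j)⁻¹) (cocompact ℂ) (𝓝 0) := by
    rw [← Metric.cobounded_eq_cocompact] at h1 ⊢
    exact (tendsto_inv₀_cobounded).comp h1
  simpa [div_eq_mul_inv] using h2.const_mul (m j : ℂ)

/-- near a pole, the sum blows up, and so does anything differing by a bounded quantity -/
theorem tendsto_sum_pole {n : ℕ} (z : Fin n → ℂ) (hz : Function.Injective z) (m : Fin n → ℝ)
    (hm : ∀ j, 0 < m j) (j : Fin n) :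
    Tendsto (fun x => ‖∑ j, (m j : ℂ) / (x - z j)‖) (𝓝[≠] (z j)) atTop := by
  have h1 : ∀ x, ∑ i, (m i : ℂ) / (x - z i) = (m j : ℂ) / (x - z j)
      + ∑ i ∈ Finset.univ.erase j, (m i : ℂ) / (x - z i) := fun x =>
    (Finset.add_sum_erase _ _ (Finset.mem_univ j)).symm
  simp_rw [h1]
  have h2 : ContinuousAt (fun x => ∑ i ∈ Finset.univ.erase j, (m i : ℂ) / (x - z i)) (z j) := by
    refine tendsto_finsetSum _ fun i hi => ?_
    refine ContinuousAt.div (by fun_prop) (by fun_prop) ?_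
    exact sub_ne_zero.2 fun h => (Finset.ne_of_mem_erase hi) (hz h).symm
  have h3 : Tendsto (fun x => ‖(m j : ℂ) / (x - z j)‖) (𝓝[≠] (z j)) atTop := by
    have h4 : Tendsto (fun x => x - z j) (𝓝[≠] (z j)) (𝓝[≠] 0) := by
      refine tendsto_nhdsWithin_of_tendsto_nhds_of_eventually_within _ ?_ ?_
      · have : ContinuousAt (fun x => x - z j) (z j) := by fun_prop
        simpa [ContinuousAt] using this.tendsto.mono_left nhdsWithin_le_nhds
      · filter_upwards [self_mem_nhdsWithin] with x hx
        exact sub_ne_zero.2 hx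
    have h5 := (tendsto_norm_cobounded_atTop.comp (tendsto_inv₀_nhdsNE_zero (α := ℂ))).comp h4
    have h6 := h5.const_mul_atTop (hm j)
    refine h6.congr fun x => ?_
    simp [div_eq_mul_inv, abs_of_pos (hm j)]
  have h7 := (h2.tendsto.norm.mono_left (nhdsWithin_le_nhds (s := {z j}ᶜ))).neg
  refine tendsto_atTop_mono (fun x => ?_) (h3.atTop_add h7)
  have := norm_sub_le_norm_add ((m j : ℂ) / (x - z j)) (∑ i ∈ Finset.univ.erase j, (m i : ℂ) / (x - z i))
  linarith

theorem tendsto_norm_add_of_continuousAt {l : Filter ℂ} {F G : ℂ → ℂ} {a : ℂ}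
    (hF : Tendsto (fun x => ‖F x‖) l atTop) (hG : Tendsto G l (𝓝 a)) :
    Tendsto (fun x => ‖G x + F x‖) l atTop := by
  have h7 := hG.norm.neg
  refine tendsto_atTop_mono (fun x => ?_) (hF.atTop_add h7)
  have := norm_sub_le_norm_add (F x) (G x)
  rw [add_comm (G x)]
  linarith

theorem tendsto_rr_pole {n : ℕ} (z : Fin n → ℂ) (hz : Function.Injective z) (m : Fin n → ℝ)
    (hm : ∀ j, 0 < m j) (g c : ℂ) (j : Fin n) :
    Tendsto (fun x => ‖rr z m g c x‖) (𝓝[≠] (z j)) atTop := by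
  refine tendsto_norm_add_of_continuousAt (tendsto_sum_pole z hz m hm j)
    (a := c + g * z j) ?_
  have : ContinuousAt (fun x => c + g * x) (z j) := by fun_prop
  exact this.tendsto.mono_left nhdsWithin_le_nhds

theorem tendsto_rr_cocompact {n : ℕ} (z : Fin n → ℂ) (m : Fin n → ℝ) (g c : ℂ) (hg : g ≠ 0) :
    Tendsto (fun x => ‖rr z m g c x‖) (cocompact ℂ) atTop := by
  have h1 : ∀ x, rr z m g c x = (c + ∑ j, (m j : ℂ) / (x - z j)) + g * x := fun x => by
    simp only [rr]; ring
  simp_rw [h1]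
  refine tendsto_norm_add_of_continuousAt ?_ ((tendsto_sum_cocompact z m).const_add c)
  simp_rw [norm_mul]
  exact (tendsto_norm_cocompact_atTop).const_mul_atTop (norm_pos_iff.2 hg)

theorem isCompact_rr_preim {n : ℕ} (z : Fin n → ℂ) (hz : Function.Injective z) (m : Fin n → ℝ)
    (hm : ∀ j, 0 < m j) (g c : ℂ) (hg : g ≠ 0) {K : Set ℂ} (hK : IsCompact K) :
    IsCompact {x | x ∈ Om z ∧ rr z m g c x ∈ K} :=
  isCompact_preim z _ (differentiableOn_rr z m g c).continuousOn (tendsto_rr_pole z hz m hm g c)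
    (tendsto_rr_cocompact z m g c hg) hK

/-- lifting through `r` -/
theorem exists_lift {n : ℕ} (z : Fin n → ℂ) (hz : Function.Injective z) (m : Fin n → ℝ)
    (hm : ∀ j, 0 < m j) (g c : ℂ) (hg : g ≠ 0) (a : ℂ) (ρ : ℝ) (hρ : 0 < ρ) (h : ℂ → ℂ)
    (hh : DifferentiableOn ℂ h (ball a ρ))
    (hreg : ∀ x ∈ ball a ρ, ∀ y ∈ Om z, rr z m g c y = h x → dr z m g y ≠ 0)
    (w : ℂ) (hw : w ∈ Om z) (hwa : rr z m g c w = h a) :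
    ∃ G : ℂ → ℂ, DifferentiableOn ℂ G (ball a ρ) ∧ G a = w ∧
      ∀ x ∈ ball a ρ, G x ∈ Om z ∧ rr z m g c (G x) = h x := by
  classical
  let p : Om z → ℂ := fun x => rr z m g c x
  have hpc : Continuous p := continuousOn_iff_continuous_domRestrict.1
    (differentiableOn_rr z m g c).continuousOn
  have hprop : IsProperMap p := by
    rw [isProperMap_iff_isCompact_preimage]
    refine ⟨hpc, fun K hK => ?_⟩
    rw [Subtype.isCompact_iff]
    convert isCompact_rr_preim z hz m hm g c hg hK using 1
    ext x
    constructor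
    · rintro ⟨y, hy, rfl⟩
      exact ⟨y.2, hy⟩
    · rintro ⟨h1, h2⟩
      exact ⟨⟨x, h1⟩, h2, rfl⟩
  let s : Set ℂ := h '' ball a ρ
  have hloc : IsLocalHomeomorphOn p (p ⁻¹' s) := by
    have h1 : IsLocalHomeomorphOn (rr z m g c) {x | x ∈ Om z ∧ dr z m g x ≠ 0} := by
      intro x hx
      have := (hasStrictDerivAt_rr z m g c hx.1)
      refine ⟨(this.hasStrictFDerivAt_equiv hx.2).toOpenPartialHomeomorph _, ?_, ?_⟩
      · exact HasStrictFDerivAt.mem_toOpenPartialHomeomorph_source _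
      · simp
    have h2 : IsLocalHomeomorph (Subtype.val : Om z → ℂ) :=
      (isOpen_Om z).isOpenEmbedding_subtypeVal.isLocalHomeomorph
    refine h1.comp (f := (Subtype.val : Om z → ℂ)) (s := p ⁻¹' s) (fun x _ => h2 x) ?_
    rintro x ⟨y, hy, hxy⟩
    exact ⟨x.2, hreg y hy x x.2 hxy.symm⟩
  have hcov : IsCoveringMapOn p s := by
    refine hprop.isClosedMap.isCoveringMapOn_of_isLocalHomeomorphOn (fun x hx => ?_) hloc
    refine (hprop.isCompact_preimage isCompact_singleton).finite
      (.of_openPartialHomeomorph p subset_rfl fun e he => ?_)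
    obtain ⟨φ, h1, h2⟩ := hloc e (by rw [mem_preimage, (he : p e = x)]; exact hx)
    exact ⟨φ, h1, h2.symm⟩
  have : ContractibleSpace (ball a ρ) :=
    (convex_ball a ρ).contractibleSpace ⟨a, mem_ball_self hρ⟩
  have : LocallyPathConnectedSpace (ball a ρ) := isOpen_ball.locallyPathConnectedSpace
  let hc : C(ball a ρ, ℂ) := ⟨fun x => h x, continuousOn_iff_continuous_domRestrict.1 hh.continuousOn⟩
  obtain ⟨F, ⟨hF1, hF2⟩, -⟩ := hcov.existsUnique_continuousMap_lifts hc
    (a₀ := ⟨a, mem_ball_self hρ⟩) (e₀ := ⟨w, hw⟩) hwa (fun x => ⟨x, x.2, rfl⟩)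
  let G : ℂ → ℂ := fun x => if hx : x ∈ ball a ρ then (F ⟨x, hx⟩ : ℂ) else 0
  have hGO : ∀ x ∈ ball a ρ, G x ∈ Om z ∧ rr z m g c (G x) = h x := by
    intro x hx
    have hGx : G x = F ⟨x, hx⟩ := dif_pos hx
    rw [hGx]
    exact ⟨(F ⟨x, hx⟩).2, congrFun hF2 ⟨x, hx⟩⟩
  have hGc : ContinuousOn G (ball a ρ) := by
    rw [continuousOn_iff_continuous_domRestrict]
    have : (ball a ρ).domRestrict G = fun x => (F x : ℂ) := by
      ext x
      exact dif_pos x.2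
    rw [this]
    fun_prop
  refine ⟨G, ?_, ?_, hGO⟩
  · intro x hx
    have hxO := (hGO x hx).1
    have hd := (hasStrictDerivAt_rr z m g c hxO)
    have hne : dr z m g (G x) ≠ 0 := hreg x hx _ hxO (hGO x hx).2
    have hcx : ContinuousAt G x := hGc.continuousAt (isOpen_ball.mem_nhds hx)
    have hd' := hd.hasStrictFDerivAt_equiv hne
    have h1 : ∀ᶠ y in 𝓝 x, hd'.localInverse _ _ _ (h y) = G y := by
      filter_upwards [hcx.eventually hd'.eventually_left_inverse, isOpen_ball.mem_nhds hx] with y hy hy2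
      rw [← (hGO y hy2).2]; exact hy
    have h2 : DifferentiableAt ℂ (hd'.localInverse _ _ _) (h x) := by
      rw [← (hGO x hx).2]
      exact hd'.to_localInverse.hasFDerivAt.differentiableAt
    have h3 : DifferentiableAt ℂ h x := hh.differentiableAt (isOpen_ball.mem_nhds hx)
    exact ((h2.comp x h3).congr_of_eventuallyEq (h1.mono fun y hy => hy.symm)).differentiableWithinAt
  · have : G a = F ⟨a, mem_ball_self hρ⟩ := by simp [G, hρ]
    rw [this, hF1]

end KN
end

section
open Set Filter Topology Metric Complex
namespace KN

/-- the antiholomorphic map whose fixed points are the images -/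
noncomputable def ff {n : ℕ} (z : Fin n → ℂ) (m : Fin n → ℝ) (g c : ℂ) (x : ℂ) : ℂ :=
  (starRingEnd ℂ) (rr z m g c x)

/-- basin of attraction -/
def basin {n : ℕ} (z : Fin n → ℂ) (m : Fin n → ℝ) (g c : ℂ) (l : Filter ℂ) : Set ℂ :=
  {w | (∀ k, (ff z m g c)^[k] w ∈ Om z) ∧ Tendsto (fun k => (ff z m g c)^[k] w) atTop l}

theorem basin_back {n : ℕ} (z : Fin n → ℂ) (m : Fin n → ℝ) (g c : ℂ) (l : Filter ℂ) (w : ℂ)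
    (hw : w ∈ Om z) (hf : ff z m g c w ∈ basin z m g c l) : w ∈ basin z m g c l := by
  refine ⟨fun k => ?_, ?_⟩
  · cases k with
    | zero => exact hw
    | succ k => exact hf.1 k
  · rw [← tendsto_add_atTop_iff_nat 1]
    exact hf.2

theorem basin_sub {n : ℕ} (z : Fin n → ℂ) (m : Fin n → ℝ) (g c : ℂ) (l : Filter ℂ) :
    basin z m g c l ⊆ Om z := fun _ hw => hw.1 0

theorem basin_disj {n : ℕ} (z : Fin n → ℂ) (m : Fin n → ℝ) (g c : ℂ) {l l' : Filter ℂ}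
    (h : Disjoint l l') : Disjoint (basin z m g c l) (basin z m g c l') := by
  rw [Set.disjoint_left]
  intro w h1 h2
  exact h1.2.not_tendsto h h2.2

theorem key_lift {n : ℕ} (z : Fin n → ℂ) (hz : Function.Injective z) (m : Fin n → ℝ)
    (hm : ∀ j, 0 < m j) (g c : ℂ) (hg : g ≠ 0) (l : Filter ℂ)
    (hcrit : ∀ w ∈ basin z m g c l, dr z m g w ≠ 0) (ρ : ℝ) (hρ : 0 < ρ) (k : ℕ) :
    ∀ w : ℂ, (∀ j < k, (ff z m g c)^[j] w ∈ Om z) → ∀ (a : ℂ) (h : ℂ → ℂ),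
      DifferentiableOn ℂ h (ball a ρ) → MapsTo h (ball a ρ) (basin z m g c l) →
      h a = (ff z m g c)^[k] w →
      ∃ (a' : ℂ) (G : ℂ → ℂ), DifferentiableOn ℂ G (ball a' ρ) ∧
        MapsTo G (ball a' ρ) (basin z m g c l) ∧ G a' = w ∧
        (∏ j ∈ Finset.range k, ‖dr z m g ((ff z m g c)^[j] w)‖) * ‖deriv G a'‖ = ‖deriv h a‖ := by
  induction k with
  | zero =>
    intro w _ a h hd hm' ha
    exact ⟨a, h, hd, hm', ha, by simp⟩
  | succ k ih =>
    intro w hw a h hd hm' ha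
    obtain ⟨a', G, hG1, hG2, hG3, hG4⟩ := ih (ff z m g c w)
      (fun j hj => by simpa using hw (j + 1) (by omega)) a h hd hm' ha
    set a2 : ℂ := (starRingEnd ℂ) a' with ha2
    let h2 : ℂ → ℂ := fun x => (starRingEnd ℂ) (G ((starRingEnd ℂ) x))
    have hball : ∀ x ∈ ball a2 ρ, (starRingEnd ℂ) x ∈ ball a' ρ := by
      intro x hx
      rw [mem_ball, dist_eq_norm] at hx ⊢
      rw [← Complex.norm_conj]
      simpa [ha2] using hx
    have hder : ∀ x ∈ ball a2 ρ,
        HasDerivAt h2 ((starRingEnd ℂ) (deriv G ((starRingEnd ℂ) x))) x := by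
      intro x hx
      have h3 : HasDerivAt G (deriv G ((starRingEnd ℂ) x)) ((starRingEnd ℂ) x) :=
        (hG1.differentiableAt (isOpen_ball.mem_nhds (hball x hx))).hasDerivAt
      have := h3.conj_conj
      simpa [h2, Function.comp_def] using this
    have hwO : w ∈ Om z := hw 0 (by omega)
    have ha2m : a2 ∈ ball a2 ρ := mem_ball_self hρ
    have hff : ∀ x ∈ ball a2 ρ, ∀ y, rr z m g c y = h2 x → ff z m g c y ∈ basin z m g c l := by
      intro x hx y hy
      have : ff z m g c y = G ((starRingEnd ℂ) x) := by
        simp [ff, hy, h2]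
      rw [this]
      exact hG2 (hball x hx)
    obtain ⟨G2, hG21, hG22, hG23⟩ := exists_lift z hz m hm g c hg a2 ρ hρ h2
      (fun x hx => (hder x hx).differentiableAt.differentiableWithinAt)
      (fun x hx y hy hxy => hcrit y (basin_back z m g c l y hy (hff x hx y hxy))) w hwO
      (by simp [h2, ha2, hG3, ff])
    refine ⟨a2, G2, hG21, fun x hx => basin_back z m g c l _ (hG23 x hx).1
      (hff x hx _ (hG23 x hx).2), hG22, ?_⟩
    have h4 : HasDerivAt G2 (deriv G2 a2) a2 :=
      (hG21.differentiableAt (isOpen_ball.mem_nhds ha2m)).hasDerivAt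
    have h5 : HasDerivAt (rr z m g c) (dr z m g w) (G2 a2) := by
      rw [hG22]; exact (hasStrictDerivAt_rr z m g c hwO).hasDerivAt
    have h6 : HasDerivAt (rr z m g c ∘ G2) (dr z m g w * deriv G2 a2) a2 := h5.comp a2 h4
    have h7 : HasDerivAt (rr z m g c ∘ G2) ((starRingEnd ℂ) (deriv G ((starRingEnd ℂ) a2))) a2 := by
      refine (hder a2 ha2m).congr_of_eventuallyEq ?_
      filter_upwards [isOpen_ball.mem_nhds ha2m] with x hx
      exact (hG23 x hx).2
    have h8 := congrArg norm (h6.unique h7)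
    rw [norm_mul, Complex.norm_conj, ha2, Complex.conj_conj] at h8
    rw [← hG4, Finset.prod_range_succ', ← h8]
    simp only [Function.iterate_succ_apply, Function.iterate_zero, id]
    ring

theorem key_bound {n : ℕ} (z : Fin n → ℂ) (hz : Function.Injective z) (m : Fin n → ℝ)
    (hm : ∀ j, 0 < m j) (g c : ℂ) (hg : g ≠ 0) (l : Filter ℂ)
    (hcrit : ∀ w ∈ basin z m g c l, dr z m g w ≠ 0) (p : ℂ) (δ : ℝ) (hδ : 0 < δ)
    (hdis : Disjoint (ball p δ) (basin z m g c l)) (w : ℂ) (hw : w ∈ basin z m g c l)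
    (k : ℕ) (ρ : ℝ) (hρ : 0 < ρ) (a : ℂ) (h : ℂ → ℂ) (hd : DifferentiableOn ℂ h (ball a ρ))
    (hmaps : MapsTo h (ball a ρ) (basin z m g c l)) (ha : h a = (ff z m g c)^[k] w) :
    ‖deriv h a‖ * ρ ≤ (∏ j ∈ Finset.range k, ‖dr z m g ((ff z m g c)^[j] w)‖) *
      (2 / δ * ‖w - p‖ ^ 2) := by
  obtain ⟨a', G, hG1, hG2, hG3, hG4⟩ := key_lift z hz m hm g c hg l hcrit ρ hρ k w
    (fun j _ => hw.1 j) a h hd hmaps ha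
  rw [← hG4, mul_assoc]
  refine mul_le_mul_of_nonneg_left ?_ (Finset.prod_nonneg fun _ _ => norm_nonneg _)
  have hfar : ∀ x ∈ ball a' ρ, δ ≤ ‖G x - p‖ := by
    intro x hx
    by_contra hlt
    rw [not_le] at hlt
    exact (Set.disjoint_left.1 hdis) (mem_ball_iff_norm.2 hlt) (hG2 hx)
  have hne : ∀ x ∈ ball a' ρ, G x - p ≠ 0 := fun x hx => norm_pos_iff.1 (hδ.trans_le (hfar x hx))
  have ham : a' ∈ ball a' ρ := mem_ball_self hρ
  have hinv : ∀ x ∈ ball a' ρ, ‖(G x - p)⁻¹‖ ≤ 1 / δ := by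
    intro x hx
    rw [norm_inv, ← one_div]
    exact one_div_le_one_div_of_le hδ (hfar x hx)
  have hS := norm_deriv_le_div_of_mapsTo_ball (f := fun x => (G x - p)⁻¹) (c := a') (R₁ := ρ)
    (R₂ := 2 / δ) ((hG1.sub_const p).inv hne) (fun x hx => by
      rw [mem_closedBall, dist_eq_norm]
      refine (norm_sub_le _ _).trans ?_
      have h1 := hinv x hx
      have h2 := hinv a' ham
      have : 2 / δ = 1 / δ + 1 / δ := by ring
      rw [this]; exact add_le_add h1 h2) hρ
  have hda : HasDerivAt G (deriv G a') a' :=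
      (hG1.differentiableAt (isOpen_ball.mem_nhds ham)).hasDerivAt
  have hda2 := (hda.sub_const p).inv (hne a' ham)
  have : deriv (fun x => (G x - p)⁻¹) a' = -deriv G a' / (G a' - p) ^ 2 := hda2.deriv
  rw [this, norm_div, norm_neg, norm_pow, hG3, div_le_div_iff₀ _ hρ] at hS
  · exact hS
  · have := hne a' ham
    rw [hG3] at this
    positivity

end KN
end

section
open Set Filter Topology Metric Complex
namespace KN

theorem petal (F : ℂ → ℂ) (hF : AnalyticAt ℂ F 0) (h0 : F 0 = 0) (h1 : deriv F 0 = 1)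
    (hne : ¬ ∀ᶠ x in 𝓝 0, F x = x) (U : Set ℂ) (hU : U ∈ 𝓝 (0 : ℂ)) :
    ∃ P : Set ℂ, P ⊆ U ∧ MapsTo F P P ∧ (∀ x ∈ P, Tendsto (fun k => F^[k] x) atTop (𝓝 0)) ∧
      ∃ w ∈ P, ∃ s > 0, ∀ k, F^[k] w ≠ 0 ∧ ball (F^[k] w) (s * ‖F^[k] w‖) ⊆ P ∧
        ‖deriv F (F^[k] w)‖ ^ 2 * ‖F^[k] w‖ ^ 3 ≤ ‖F^[k + 1] w‖ ^ 3 := by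
  have hE : AnalyticAt ℂ (fun x => F x - x) 0 := hF.sub analyticAt_id
  obtain ⟨N, G, hG, hG0, hFG⟩ := (hE.exists_eventuallyEq_pow_smul_nonzero_iff).2 (by
    intro h; exact hne (h.mono fun x hx => sub_eq_zero.1 hx))
  simp only [sub_zero, smul_eq_mul] at hFG
  have hN2 : ∃ p : ℕ, 1 ≤ p ∧ N = p + 1 := by
    have hN0 : N ≠ 0 := by
      rintro rfl
      have := hFG.self_of_nhds
      simp [h0] at this
      exact hG0 this.symm
    have hN1 : N ≠ 1 := by
      rintro rfl
      have e1 : HasDerivAt (fun x => F x - x) (1 - 1) 0 := by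
        have := hF.differentiableAt.hasDerivAt
        rw [h1] at this
        exact this.sub (hasDerivAt_id 0)
      have e2 : HasDerivAt (fun x => x * G x) (1 * G 0 + 0 * deriv G 0) 0 :=
        (hasDerivAt_id (0 : ℂ)).mul hG.differentiableAt.hasDerivAt
      have hFG1 : (fun x => F x - x) =ᶠ[𝓝 0] fun x => x * G x := by
        filter_upwards [hFG] with x hx
        simpa using hx
      have e3 := e2.congr_of_eventuallyEq hFG1
      have := e1.unique e3
      simp at this
      exact hG0 this.symm
    exact ⟨N - 1, by omega, by omega⟩
  obtain ⟨p, hp, rfl⟩ := hN2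
  set a := G 0 with ha
  let u : ℂ → ℂ := fun x => -(a * x ^ p)⁻¹
  have hGc : Tendsto G (𝓝[≠] 0) (𝓝 a) := hG.continuousAt.tendsto.mono_left nhdsWithin_le_nhds
  have hxp : Tendsto (fun x : ℂ => x ^ p) (𝓝[≠] 0) (𝓝 0) := by
    have : ContinuousAt (fun x : ℂ => x ^ p) 0 := by fun_prop
    have := this.tendsto.mono_left (nhdsWithin_le_nhds (s := {(0 : ℂ)}ᶜ))
    simpa [zero_pow (by omega : p ≠ 0)] using this
  have hFG' : ∀ᶠ x in 𝓝[≠] (0 : ℂ), F x = x * (1 + x ^ p * G x) := by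
    filter_upwards [nhdsWithin_le_nhds hFG] with x hx
    have : F x = x + (F x - x) := by ring
    rw [this, hx]; ring
  have hxne : ∀ᶠ x in 𝓝[≠] (0 : ℂ), x ≠ 0 := self_mem_nhdsWithin
  have hsmall : Tendsto (fun x => 1 + x ^ p * G x) (𝓝[≠] 0) (𝓝 1) := by
    simpa using (hxp.mul hGc).const_add 1
  -- first limit
  have L1 : Tendsto (fun x => u (F x) - u x) (𝓝[≠] 0) (𝓝 (p : ℂ)) := by
    let φ : ℂ → ℂ := fun t => ((1 + t) ^ p)⁻¹
    have hφ : HasDerivAt φ (-(p : ℂ)) 0 := by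
      have e1 : HasDerivAt (fun t : ℂ => (1 + t) ^ p) (p * (1 + 0) ^ (p - 1) * 1) 0 :=
        ((hasDerivAt_id (0 : ℂ)).const_add 1).pow p
      have e2 : HasDerivAt φ _ 0 := e1.inv (by simp)
      exact e2.congr_deriv (by simp)
    have hd : ContinuousAt (dslope φ 0) 0 := continuousAt_dslope_same.2 hφ.differentiableAt
    have e1 : Tendsto (fun x => dslope φ 0 (x ^ p * G x)) (𝓝[≠] 0) (𝓝 (-(p : ℂ))) := by
      have e2 : Tendsto (fun x => x ^ p * G x) (𝓝[≠] 0) (𝓝 0) := by simpa using hxp.mul hGc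
      have := hd.tendsto.comp e2
      rwa [dslope_same, hφ.deriv] at this
    have e3 : Tendsto (fun x => -(a⁻¹ * G x) * dslope φ 0 (x ^ p * G x)) (𝓝[≠] 0)
        (𝓝 (-(a⁻¹ * a) * (-(p : ℂ)))) := ((hGc.const_mul a⁻¹).neg).mul e1
    have e4 : -(a⁻¹ * a) * (-(p : ℂ)) = p := by field_simp
    rw [e4] at e3
    refine e3.congr' ?_
    filter_upwards [hFG', hxne] with x hx hx0
    have e5 := sub_smul_dslope φ 0 (x ^ p * G x)
    simp only [sub_zero, smul_eq_mul, φ, add_zero, one_pow, inv_one] at e5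
    have e6 : u (F x) = u x * ((1 + x ^ p * G x) ^ p)⁻¹ := by
      simp only [u, hx, mul_pow, mul_inv]; ring
    have e7 : u (F x) - u x = u x * (((1 + x ^ p * G x) ^ p)⁻¹ - 1) := by rw [e6]; ring
    rw [e7, ← e5]
    simp only [u, φ]
    have : x ^ p ≠ 0 := pow_ne_zero _ hx0
    field_simp
  -- second limit
  have hFd : ∀ᶠ x in 𝓝[≠] (0 : ℂ),
      deriv F x = 1 + x ^ p * ((p + 1) * G x + x * deriv G x) := by
    have e1 : ∀ᶠ x in 𝓝 (0 : ℂ), ∀ᶠ y in 𝓝 x, F y - y = y ^ (p + 1) * G y :=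
      hFG.eventually_nhds
    filter_upwards [nhdsWithin_le_nhds e1, nhdsWithin_le_nhds hG.eventually_analyticAt] with x hx hGx
    have e2 : F =ᶠ[𝓝 x] fun y => y + y ^ (p + 1) * G y := by
      filter_upwards [hx] with y hy
      rw [← hy]; ring
    rw [e2.deriv_eq]
    have e3 : HasDerivAt (fun y => y + y ^ (p + 1) * G y)
        (1 + (((p + 1 : ℕ) : ℂ) * x ^ (p + 1 - 1) * 1 * G x + x ^ (p + 1) * deriv G x)) x :=
      (hasDerivAt_id x).add (((hasDerivAt_id x).pow (p + 1)).mul hGx.differentiableAt.hasDerivAt)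
    rw [e3.deriv]
    push_cast
    ring
  have hα : Tendsto (fun x => ((p : ℂ) + 1) * G x + x * deriv G x) (𝓝[≠] 0) (𝓝 ((p + 1) * a)) := by
    have e1 : ContinuousAt (deriv G) 0 := hG.deriv.continuousAt
    have e2 : Tendsto (fun x : ℂ => x) (𝓝[≠] 0) (𝓝 0) := tendsto_id.mono_left nhdsWithin_le_nhds
    simpa using (hGc.const_mul ((p : ℂ) + 1)).add
      (e2.mul (e1.tendsto.mono_left nhdsWithin_le_nhds))
  have L2 : Tendsto (fun x => u x * (1 - (deriv F x) ^ 2 / (F x / x) ^ 3)) (𝓝[≠] 0)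
      (𝓝 ((2 * p - 1 : ℝ) : ℂ)) := by
    have e1 := ((((hGc.const_mul 3).add ((hxp.mul (hGc.pow 2)).const_mul 3)).add
      ((hxp.pow 2).mul (hGc.pow 3))).sub (hα.const_mul 2)).sub (hxp.mul (hα.pow 2))
    have e2 := (e1.div (hsmall.pow 3) (by simp)).const_mul (-a⁻¹)
    have e3 : -a⁻¹ * ((3 * a + 3 * (0 * a ^ 2) + 0 ^ 2 * a ^ 3 - 2 * ((↑p + 1) * a) -
        0 * ((↑p + 1) * a) ^ 2) / 1 ^ 3) = ((2 * p - 1 : ℝ) : ℂ) := by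
      push_cast; field_simp; ring
    rw [e3] at e2
    refine e2.congr' ?_
    filter_upwards [hFG', hxne, hFd, hsmall.eventually_ne one_ne_zero] with x hx hx0 hdx hB
    have hx' : F x / x = 1 + x ^ p * G x := by rw [hx]; field_simp
    rw [hx', hdx]
    simp only [Pi.div_apply]
    have hxp0 : x ^ p ≠ 0 := pow_ne_zero _ hx0
    simp only [u]
    generalize ((p : ℂ) + 1) * G x + x * deriv G x = A
    have hB3 : (1 + x ^ p * G x) ^ 3 ≠ 0 := pow_ne_zero _ hB
    rw [one_sub_div hB3, mul_div_assoc', mul_div_assoc']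
    congr 1
    field_simp
    ring
  -- choose the radius
  have hev : ∀ᶠ x in 𝓝[≠] (0 : ℂ), x ∈ U ∧ ‖u (F x) - u x - p‖ ≤ 1 / 2 ∧
      ‖u x * (1 - (deriv F x) ^ 2 / (F x / x) ^ 3) - ((2 * p - 1 : ℝ) : ℂ)‖ ≤ 1 / 4 ∧
      F x ≠ 0 ∧ x ≠ 0 := by
    have e1 := L1.eventually (Metric.closedBall_mem_nhds _ (by norm_num : (0 : ℝ) < 1 / 2))
    have e2 := L2.eventually (Metric.closedBall_mem_nhds _ (by norm_num : (0 : ℝ) < 1 / 4))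
    filter_upwards [nhdsWithin_le_nhds hU, e1, e2, hFG', hxne, hsmall.eventually_ne one_ne_zero]
      with x a1 a2 a3 a4 a5 a6
    rw [dist_eq_norm] at a2 a3
    exact ⟨a1, a2, a3, by rw [a4]; exact mul_ne_zero a5 a6, a5⟩
  rw [eventually_nhdsWithin_iff, Metric.eventually_nhds_iff] at hev
  obtain ⟨ε, hε, hev⟩ := hev
  have hapos : 0 < ‖a‖ := norm_pos_iff.2 hG0
  have hunorm : ∀ x, ‖u x‖ = (‖a‖ * ‖x‖ ^ p)⁻¹ := fun x => by simp [u]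
  have hsm : ∀ e > 0, ∀ x, (‖a‖ * e ^ p)⁻¹ < (u x).re → x ≠ 0 ∧ ‖x‖ < e := by
    intro e he x hx
    have hpos : 0 < (‖a‖ * e ^ p)⁻¹ := by positivity
    have h3 : (‖a‖ * e ^ p)⁻¹ < ‖u x‖ := hx.trans_le (Complex.re_le_norm _)
    refine ⟨?_, ?_⟩
    · rintro rfl
      rw [hunorm, norm_zero, zero_pow (by omega), mul_zero, inv_zero] at h3
      linarith
    · by_contra hcon
      rw [not_lt] at hcon
      rw [hunorm] at h3
      have : (‖a‖ * ‖x‖ ^ p)⁻¹ ≤ (‖a‖ * e ^ p)⁻¹ := by gcongr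
      linarith
  set M := (‖a‖ * ε ^ p)⁻¹ with hM
  have hMpos : 0 < M := by positivity
  have hstep : ∀ x, M < (u x).re → x ∈ U ∧ ‖u (F x) - u x - p‖ ≤ 1 / 2 ∧
      ‖u x * (1 - (deriv F x) ^ 2 / (F x / x) ^ 3) - ((2 * p - 1 : ℝ) : ℂ)‖ ≤ 1 / 4 ∧
      F x ≠ 0 ∧ x ≠ 0 := by
    intro x hx
    obtain ⟨q1, q2⟩ := hsm ε hε x hx
    exact hev (by simpa using q2) q1
  have hp' : (1 : ℝ) ≤ p := by exact_mod_cast hp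
  have hre : ∀ x, M < (u x).re → (u x).re + 1 / 2 ≤ (u (F x)).re := by
    intro x hx
    have h3 := (Complex.abs_re_le_norm _).trans (hstep x hx).2.1
    simp only [Complex.sub_re, Complex.natCast_re] at h3
    have := (abs_le.1 h3).1
    linarith
  have him : ∀ x, M < (u x).re → |(u (F x)).im| ≤ |(u x).im| + 1 / 2 := by
    intro x hx
    have h3 := (Complex.abs_im_le_norm _).trans (hstep x hx).2.1
    simp only [Complex.sub_im, Complex.natCast_im, sub_zero] at h3
    have := abs_sub_abs_le_abs_sub (u (F x)).im (u x).im
    linarith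
  have hiter : ∀ x, M < (u x).re → ∀ k : ℕ, (u x).re + k / 2 ≤ (u (F^[k] x)).re := by
    intro x hx k
    induction k with
    | zero => simp
    | succ k ih =>
      rw [Function.iterate_succ_apply']
      have h3 : M < (u (F^[k] x)).re := by
        have : (0 : ℝ) ≤ (k : ℝ) / 2 := by positivity
        linarith
      have := hre _ h3
      push_cast
      linarith
  refine ⟨{x | M < (u x).re}, fun x hx => (hstep x hx).1, fun x hx => ?_, fun x hx => ?_, ?_⟩
  · have := hre x hx
    have h3 : M < (u x).re := hx
    show M < (u (F x)).re
    linarith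
  · rw [Metric.tendsto_atTop]
    intro e he
    obtain ⟨K, hK⟩ := exists_nat_gt (2 * (‖a‖ * e ^ p)⁻¹)
    refine ⟨K, fun k hk => ?_⟩
    have h3 := hiter x hx k
    have h4 : M < (u x).re := hx
    have h5 : (K : ℝ) ≤ k := by exact_mod_cast hk
    simpa using (hsm e he (F^[k] x) (by linarith)).2
  · set κ : ℝ := 2 * p - 1 with hκ
    have hκ1 : 1 ≤ κ := by linarith
    set T : ℝ := 2 * M + 4 * κ + 1 with hT
    have hTpos : 0 < T := by positivity
    have hTne : (T : ℂ) ≠ 0 := by exact_mod_cast hTpos.ne'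
    obtain ⟨w, hw⟩ := IsAlgClosed.exists_pow_nat_eq (-(a * T)⁻¹ : ℂ) (show 0 < p by omega)
    have huw : u w = T := by
      simp only [u, hw]
      field_simp
    obtain ⟨s, hs, hsb⟩ : ∃ s > 0, ∀ y : ℂ, dist y 1 < s → dist ((y ^ p)⁻¹) 1 < 1 / 4 := by
      have : ContinuousAt (fun y : ℂ => (y ^ p)⁻¹) 1 := by
        refine ContinuousAt.inv₀ (by fun_prop) (by simp)
      obtain ⟨s, hs, h⟩ := Metric.continuousAt_iff.1 this (1 / 4) (by norm_num)
      refine ⟨s, hs, fun y hy => by simpa using h hy⟩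
    have hcone : ∀ k : ℕ, T ≤ (u (F^[k] w)).re ∧ |(u (F^[k] w)).im| ≤ (u (F^[k] w)).re := by
      intro k
      induction k with
      | zero => simp [huw, hTpos.le]
      | succ k ih =>
        rw [Function.iterate_succ_apply']
        have h3 : M < (u (F^[k] w)).re := by linarith
        have := hre _ h3
        have := him _ h3
        exact ⟨by linarith, by linarith⟩
    refine ⟨w, ?_, s, hs, fun k => ?_⟩
    · show M < (u w).re
      rw [huw, Complex.ofReal_re]; linarith
    obtain ⟨c1, c2⟩ := hcone k
    rw [Function.iterate_succ_apply']
    set y := F^[k] w with hy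
    have hMy : M < (u y).re := by linarith
    obtain ⟨-, -, q3, q4, q5⟩ := hstep y hMy
    have hnorm : ‖u y‖ ≤ 2 * (u y).re := by
      have := Complex.norm_le_abs_re_add_abs_im (u y)
      rw [abs_of_pos (by linarith : 0 < (u y).re)] at this
      linarith
    refine ⟨q5, ?_, ?_⟩
    · intro x hx
      rw [mem_ball, dist_eq_norm] at hx
      have h4 : dist (x / y) 1 < s := by
        rw [dist_eq_norm, show x / y - 1 = (x - y) / y by field_simp, norm_div,
          div_lt_iff₀ (norm_pos_iff.2 q5)]
        exact hx
      have h5 := hsb _ h4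
      have h6 : u x = u y * ((x / y) ^ p)⁻¹ := by
        simp only [u, div_pow]
        have : y ^ p ≠ 0 := pow_ne_zero _ q5
        rw [inv_div, mul_inv, mul_inv, div_eq_mul_inv]
        field_simp
      have h7 : u x - u y = u y * (((x / y) ^ p)⁻¹ - 1) := by rw [h6]; ring
      have h8 : ‖u x - u y‖ ≤ ‖u y‖ * (1 / 4) := by
        rw [h7, norm_mul]
        rw [dist_eq_norm] at h5
        gcongr
      have h9 := (Complex.abs_re_le_norm _).trans h8
      rw [Complex.sub_re] at h9
      have := (abs_le.1 h9).1
      show M < (u x).re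
      linarith
    · -- derivative bound
      set C := (deriv F y) ^ 2 / (F y / y) ^ 3 with hC
      set v := u y * (1 - C) with hv
      have hv1 := (Complex.abs_re_le_norm _).trans q3
      have hv2 := (Complex.abs_im_le_norm _).trans q3
      rw [Complex.sub_re, Complex.ofReal_re] at hv1
      rw [Complex.sub_im, Complex.ofReal_im, sub_zero] at hv2
      have hu0 : u y ≠ 0 := by
        intro h; rw [h] at c1; simp at c1; linarith
      have hCu : u y * C = u y - v := by rw [hv]; ring
      have hle : ‖u y - v‖ ≤ ‖u y‖ := by
        rw [← sq_le_sq₀ (norm_nonneg _) (norm_nonneg _), Complex.sq_norm, Complex.sq_norm,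
          Complex.normSq_apply, Complex.normSq_apply, Complex.sub_re, Complex.sub_im]
        have a1 := abs_le.1 hv1
        have a2 := abs_le.1 hv2
        have a3 := abs_le.1 c2
        have b1 : -((u y).re * (1 / 4)) ≤ (u y).im * v.im := by
          have : |(u y).im * v.im| ≤ (u y).re * (1 / 4) := by
            rw [abs_mul]; exact mul_le_mul c2 hv2 (abs_nonneg _) (by linarith)
          exact (abs_le.1 this).1
        have b2 : (u y).re * (κ - 1 / 4) ≤ (u y).re * v.re := by
          apply mul_le_mul_of_nonneg_left _ (by linarith); linarith
        have b3 : v.re ^ 2 ≤ (κ + 1 / 4) ^ 2 := by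
          apply sq_le_sq'
          · linarith
          · linarith
        have b4 : v.im ^ 2 ≤ (1 / 4) ^ 2 := by
          apply sq_le_sq' <;> linarith
        have b5 : 4 * κ * κ ≤ (u y).re * κ := by
          apply mul_le_mul_of_nonneg_right _ (by linarith); linarith
        nlinarith
      have hC1 : ‖C‖ ≤ 1 := by
        rw [← hCu, norm_mul] at hle
        have : 0 < ‖u y‖ := norm_pos_iff.2 hu0
        nlinarith
      have hy3 : 0 < ‖y‖ := norm_pos_iff.2 q5
      have hF3 : 0 < ‖F y‖ := norm_pos_iff.2 q4
      rw [hC, norm_div, norm_pow, norm_pow, norm_div, div_pow, div_div_eq_mul_div,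
        div_le_one (by positivity)] at hC1
      exact hC1

end KN
end

section
open Set Filter Topology Metric Complex
namespace KN

theorem crit_finite {n : ℕ} (hn : 2 ≤ n) (z : Fin n → ℂ) (hz : Function.Injective z)
    (m : Fin n → ℝ) (hm : ∀ j, 0 < m j) (g : ℂ) :
    {x | x ∈ Om z ∧ dr z m g x = 0}.Finite ∧ {x | x ∈ Om z ∧ dr z m g x = 0}.ncard ≤ 2 * n := by
  classical
  let q : Polynomial ℂ := Polynomial.C g * ∏ j, (Polynomial.X - Polynomial.C (z j)) ^ 2 -
    ∑ j, Polynomial.C (m j : ℂ) * ∏ i ∈ Finset.univ.erase j, (Polynomial.X - Polynomial.C (z i)) ^ 2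
  have hprod : ∀ s : Finset (Fin n),
      (∏ i ∈ s, (Polynomial.X - Polynomial.C (z i)) ^ 2).natDegree ≤ 2 * n := by
    intro s
    refine (Polynomial.natDegree_prod_le _ _).trans ?_
    refine (Finset.sum_le_card_nsmul _ _ 2 fun i _ => ?_).trans ?_
    · simp [Polynomial.natDegree_pow]
    · have := Finset.card_le_univ s
      simp at this
      simp only [smul_eq_mul]
      omega
  have hdeg : q.natDegree ≤ 2 * n := by
    refine (Polynomial.natDegree_sub_le _ _).trans (max_le ?_ ?_)
    · exact (Polynomial.natDegree_C_mul_le _ _).trans (hprod _)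
    · refine Polynomial.natDegree_sum_le_of_forall_le _ _ fun j _ => ?_
      exact (Polynomial.natDegree_C_mul_le _ _).trans (hprod _)
  have hq0 : q ≠ 0 := by
    intro h
    have h1 := congrArg (Polynomial.eval (z ⟨0, by omega⟩)) h
    set j0 : Fin n := ⟨0, by omega⟩
    simp only [q, Polynomial.eval_sub, Polynomial.eval_mul, Polynomial.eval_C,
      Polynomial.eval_prod, Polynomial.eval_pow, Polynomial.eval_X, Polynomial.eval_finsetSum,
      Polynomial.eval_zero] at h1
    rw [Finset.prod_eq_zero (Finset.mem_univ j0) (by simp),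
      Finset.sum_eq_single j0] at h1
    · rw [mul_zero, zero_sub, neg_eq_zero, mul_eq_zero] at h1
      rcases h1 with h1 | h1
      · have := hm j0
        have h2 : m j0 = 0 := by exact_mod_cast h1
        linarith
      · rw [Finset.prod_eq_zero_iff] at h1
        obtain ⟨i, hi, h2⟩ := h1
        have : z j0 = z i := sub_eq_zero.1 (pow_eq_zero_iff (two_ne_zero) |>.1 h2)
        exact (Finset.mem_erase.1 hi).1 (hz this).symm
    · intro j _ hj
      rw [Finset.prod_eq_zero (i := j0) (by simp [hj.symm]) (by simp), mul_zero]
    · simp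
  have hsub : {x | x ∈ Om z ∧ dr z m g x = 0} ⊆ (q.roots.toFinset : Set ℂ) := by
    rintro x ⟨hx, hd⟩
    simp only [Finset.mem_coe, Multiset.mem_toFinset, Polynomial.mem_roots hq0, Polynomial.IsRoot]
    have h1 : ∀ j, (x - z j) ^ 2 ≠ 0 := fun j => pow_ne_zero _ (sub_ne_zero.2 (hx j))
    have : q.eval x = (∏ j, (x - z j) ^ 2) * dr z m g x := by
      simp only [q, Polynomial.eval_sub, Polynomial.eval_mul, Polynomial.eval_C,
        Polynomial.eval_prod, Polynomial.eval_pow, Polynomial.eval_X, Polynomial.eval_finsetSum, dr,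
        mul_sub, Finset.mul_sum]
      rw [mul_comm g]
      congr 1
      refine Finset.sum_congr rfl fun j _ => ?_
      rw [← Finset.mul_prod_erase _ _ (Finset.mem_univ j)]
      have := sub_ne_zero.2 (hx j)
      field_simp
    rw [this, hd, mul_zero]
  refine ⟨(Finset.finite_toSet _).subset hsub, ?_⟩
  refine (Set.ncard_le_ncard hsub (Finset.finite_toSet _)).trans ?_
  rw [Set.ncard_coe_finset]
  exact (Multiset.toFinset_card_le _).trans ((Polynomial.card_roots' _).trans hdeg)

/-- an attractor -/
def good {n : ℕ} (z : Fin n → ℂ) (m : Fin n → ℝ) (g c : ℂ) (l : Filter ℂ) : Prop :=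
  (∃ p, ∃ δ > 0, ball p δ ⊆ basin z m g c l) ∧
  ∀ p, ∀ δ > 0, Disjoint (ball p δ) (basin z m g c l) → ∃ w ∈ basin z m g c l, dr z m g w = 0

theorem good_attr {n : ℕ} (z : Fin n → ℂ) (hz : Function.Injective z)
    (m : Fin n → ℝ) (hm : ∀ j, 0 < m j) (g c : ℂ) (hg : g ≠ 0) (z0 : ℂ) (h0 : z0 ∈ Om z)
    (hfix : ff z m g c z0 = z0) (hd : ‖dr z m g z0‖ < 1) : good z m g c (𝓝 z0) := by
  obtain ⟨q, hq1, hq2⟩ := exists_between hd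
  have hq0 : 0 ≤ q := (norm_nonneg _).trans hq1.le
  have hder := (hasStrictDerivAt_rr z m g c h0).hasDerivAt
  rw [hasDerivAt_iff_isLittleO] at hder
  have hev := hder.def (sub_pos.2 hq1)
  have hO := (isOpen_Om z).mem_nhds h0
  obtain ⟨ε, hε, hb⟩ := Metric.eventually_nhds_iff_ball.1 (hev.and hO)
  have hcon : ∀ x ∈ ball z0 ε, ‖ff z m g c x - z0‖ ≤ q * ‖x - z0‖ := by
    intro x hx
    have h1 := (hb x hx).1
    have h2 : ff z m g c x - z0 = (starRingEnd ℂ) (rr z m g c x - rr z m g c z0) := by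
      rw [map_sub]
      conv_lhs => rw [← hfix]
      rfl
    rw [h2, Complex.norm_conj]
    have h3 := norm_le_norm_add_norm_sub' (rr z m g c x - rr z m g c z0) ((x - z0) • dr z m g z0)
    rw [norm_smul] at h3
    nlinarith
  have hit : ∀ x ∈ ball z0 ε, ∀ k, ‖(ff z m g c)^[k] x - z0‖ ≤ q ^ k * ‖x - z0‖ := by
    intro x hx k
    induction k with
    | zero => simp
    | succ k ih =>
      have hxk : (ff z m g c)^[k] x ∈ ball z0 ε := by
        rw [mem_ball_iff_norm] at hx ⊢
        refine (ih.trans ?_).trans_lt hx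
        exact mul_le_of_le_one_left (norm_nonneg _) (pow_le_one₀ hq0 hq2.le)
      rw [Function.iterate_succ_apply']
      refine (hcon _ hxk).trans ?_
      rw [pow_succ']
      nlinarith
  have hball : ball z0 ε ⊆ basin z m g c (𝓝 z0) := by
    intro x hx
    refine ⟨fun k => ?_, ?_⟩
    · refine (hb _ ?_).2
      have := hit x hx k
      rw [mem_ball_iff_norm] at hx ⊢
      refine (this.trans ?_).trans_lt hx
      exact mul_le_of_le_one_left (norm_nonneg _) (pow_le_one₀ hq0 hq2.le)
    · rw [tendsto_iff_norm_sub_tendsto_zero]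
      refine squeeze_zero (fun _ => norm_nonneg _) (hit x hx) ?_
      simpa using (tendsto_pow_atTop_nhds_zero_of_lt_one hq0 hq2).mul_const ‖x - z0‖
  refine ⟨⟨z0, ε, hε, hball⟩, fun p δ hδ hdis => ?_⟩
  by_contra hcon'
  push Not at hcon'
  have hiter : ∀ k, (ff z m g c)^[k] z0 = z0 := fun k => Function.iterate_fixed hfix k
  have hk : ∀ k : ℕ, ε ≤ ‖dr z m g z0‖ ^ k * (2 / δ * ‖z0 - p‖ ^ 2) := by
    intro k
    have := key_bound z hz m hm g c hg (𝓝 z0) hcon' p δ hδ hdis z0 (hball (mem_ball_self hε)) k ε hε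
      z0 id differentiableOn_id hball (by rw [hiter]; rfl)
    simpa [hiter] using this
  have ht : Tendsto (fun k => ‖dr z m g z0‖ ^ k * (2 / δ * ‖z0 - p‖ ^ 2)) atTop (𝓝 0) := by
    simpa using (tendsto_pow_atTop_nhds_zero_of_lt_one (norm_nonneg _) hd).mul_const
      (2 / δ * ‖z0 - p‖ ^ 2)
  have := ge_of_tendsto' ht hk
  linarith

end KN
end

section
open Set Filter Topology Metric Complex
namespace KN

theorem ff_continuousAt {n : ℕ} (z : Fin n → ℂ) (m : Fin n → ℝ) (g c : ℂ) {x : ℂ}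
    (hx : x ∈ Om z) : ContinuousAt (ff z m g c) x :=
  Complex.continuous_conj.continuousAt.comp
    (hasStrictDerivAt_rr z m g c hx).hasDerivAt.continuousAt

theorem norm_ff {n : ℕ} (z : Fin n → ℂ) (m : Fin n → ℝ) (g c : ℂ) (x : ℂ) :
    ‖ff z m g c x‖ = ‖rr z m g c x‖ := Complex.norm_conj _

theorem hasDerivAt_QQ {n : ℕ} (z : Fin n → ℂ) (m : Fin n → ℝ) (g c : ℂ) {x : ℂ}
    (hx : x ∈ Om z) (hfx : ff z m g c x ∈ Om z) :
    HasDerivAt (fun y => ff z m g c (ff z m g c y))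
      ((starRingEnd ℂ) (dr z m g (ff z m g c x)) * dr z m g x) x := by
  have h1 := (hasStrictDerivAt_rr z m g c hx).hasDerivAt
  have h2 := (hasStrictDerivAt_rr z m g c hfx).hasDerivAt
  have h3 := h2.conj_conj
  simp only [ff, Complex.conj_conj] at h3
  have h4 := h3.comp x h1
  simpa [Function.comp_def, ff] using h4

theorem isOpen_VV {n : ℕ} (z : Fin n → ℂ) (m : Fin n → ℝ) (g c : ℂ) :
    IsOpen {x | x ∈ Om z ∧ ff z m g c x ∈ Om z} := by
  have h : ContinuousOn (ff z m g c) (Om z) := fun x hx =>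
    (ff_continuousAt z m g c hx).continuousWithinAt
  exact h.isOpen_inter_preimage (isOpen_Om z) (isOpen_Om z)

theorem isPreconnected_Om {n : ℕ} (z : Fin n → ℂ) : IsPreconnected (Om z) := by
  have h : (Set.range z)ᶜ = Om z := by
    ext x; simp [Om, eq_comm]
  rw [← h]
  refine ((Set.finite_range z).countable.isConnected_compl_of_one_lt_rank ?_).isPreconnected
  simp [Complex.rank_real_complex]

theorem QQ_ne_id {n : ℕ} (hn : 2 ≤ n) (z : Fin n → ℂ) (hz : Function.Injective z)
    (m : Fin n → ℝ) (hm : ∀ j, 0 < m j) (g c : ℂ) (hg : g ≠ 0) (z0 : ℂ) (h0 : z0 ∈ Om z)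
    (hf0 : ff z m g c z0 ∈ Om z) :
    ¬ ∀ᶠ x in 𝓝 z0, ff z m g c (ff z m g c x) = x := by
  intro hev
  set V := {x | x ∈ Om z ∧ ff z m g c x ∈ Om z} with hV
  have hVo : IsOpen V := isOpen_VV z m g c
  let A : Set ℂ := {x | x ∈ V ∧ ∀ᶠ y in 𝓝 x, ff z m g c (ff z m g c y) = y}
  have hAo : IsOpen A := by
    rw [isOpen_iff_mem_nhds]
    rintro x ⟨hx1, hx2⟩
    filter_upwards [hVo.mem_nhds hx1, hx2.eventually_nhds] with y h1 h2 using ⟨h1, h2⟩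
  have hsub : Om z ⊆ A := by
    refine (isPreconnected_Om z).subset_of_closure_inter_subset hAo ⟨z0, h0, ⟨h0, hf0⟩, hev⟩ ?_
    rintro x ⟨hx, hxO⟩
    have hfr := mem_closure_iff_frequently.1 hx
    by_cases hfx : ff z m g c x ∈ Om z
    · obtain ⟨ε, hε, hb⟩ := Metric.isOpen_iff.1 hVo x ⟨hxO, hfx⟩
      obtain ⟨y, hyA, hyb⟩ := (hfr.and_eventually (ball_mem_nhds x hε)).exists
      have han : AnalyticOnNhd ℂ (fun y => ff z m g c (ff z m g c y)) (ball x ε) := by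
        refine DifferentiableOn.analyticOnNhd (fun u hu => ?_) isOpen_ball
        exact (hasDerivAt_QQ z m g c (hb hu).1 (hb hu).2).differentiableAt.differentiableWithinAt
      have heq := han.eqOn_of_preconnected_of_eventuallyEq (g := fun y => y)
        (fun u _ => analyticAt_id) (convex_ball x ε).isPreconnected hyb hyA.2
      exact ⟨⟨hxO, hfx⟩, by filter_upwards [ball_mem_nhds x hε] with u hu using heq hu⟩
    · exfalso
      have : ∃ j, ff z m g c x = z j := by
        simpa [Om] using hfx
      obtain ⟨j, hj⟩ := this
      have h1 := (tendsto_rr_pole z hz m hm g c j).eventually_gt_atTop (‖x‖ + 1)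
      rw [eventually_nhdsWithin_iff, ← hj] at h1
      have h2 := (ff_continuousAt z m g c hxO).eventually h1
      have h3 : ∀ᶠ y in 𝓝 x, ‖y‖ < ‖x‖ + 1 :=
        continuous_norm.continuousAt.eventually_lt continuousAt_const (by linarith)
      obtain ⟨y, hyA, hy2, hy3⟩ := (hfr.and_eventually (h2.and h3)).exists
      have h4 := hy2 (by
        rw [hj]; exact hyA.1.2 j)
      rw [← norm_ff, hyA.2.self_of_nhds] at h4
      linarith
  -- now near a pole
  set j0 : Fin n := ⟨0, by omega⟩
  have h1 : Tendsto (ff z m g c) (𝓝[≠] (z j0)) (cocompact ℂ) := by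
    rw [← Metric.cobounded_eq_cocompact, ← tendsto_norm_atTop_iff_cobounded]
    simpa [norm_ff] using tendsto_rr_pole z hz m hm g c j0
  have h2 : Tendsto (fun x => ‖ff z m g c (ff z m g c x)‖) (𝓝[≠] (z j0)) atTop := by
    have := (tendsto_rr_cocompact z m g c hg).comp h1
    simpa [norm_ff, Function.comp_def] using this
  have h3 : ∀ᶠ x in 𝓝[≠] (z j0), x ∈ Om z := by
    have : ∀ᶠ x in 𝓝[≠] (z j0), ∀ j, x ≠ z j := by
      rw [eventually_all]
      intro j
      by_cases hj : j = j0
      · rw [hj]; exact self_mem_nhdsWithin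
      · exact nhdsWithin_le_nhds (isOpen_ne.mem_nhds fun h => hj (hz h).symm)
    exact this
  have h4 : ∀ᶠ y in 𝓝[≠] (z j0), ‖y‖ < ‖z j0‖ + 1 :=
    nhdsWithin_le_nhds (continuous_norm.continuousAt.eventually_lt continuousAt_const (by linarith))
  obtain ⟨y, hy1, hy2, hy3⟩ :=
    ((h2.eventually_gt_atTop (‖z j0‖ + 1)).and (h3.and h4)).exists
  rw [(hsub hy2).2.self_of_nhds] at hy1
  linarith

theorem good_neutral {n : ℕ} (hn : 2 ≤ n) (z : Fin n → ℂ) (hz : Function.Injective z)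
    (m : Fin n → ℝ) (hm : ∀ j, 0 < m j) (g c : ℂ) (hg : g ≠ 0) (z0 : ℂ) (h0 : z0 ∈ Om z)
    (hfix : ff z m g c z0 = z0) (hd : ‖dr z m g z0‖ = 1) : good z m g c (𝓝 z0) := by
  set f := ff z m g c with hf
  set V := {x | x ∈ Om z ∧ f x ∈ Om z} with hV
  have hVo : IsOpen V := isOpen_VV z m g c
  have hf0 : f z0 ∈ Om z := by rw [hfix]; exact h0
  let F : ℂ → ℂ := fun x => f (f (z0 + x)) - z0
  have hFd : ∀ x, z0 + x ∈ V → HasDerivAt F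
      ((starRingEnd ℂ) (dr z m g (f (z0 + x))) * dr z m g (z0 + x)) x := by
    intro x hx
    have h1 := hasDerivAt_QQ z m g c hx.1 hx.2
    exact (h1.comp_const_add z0 x).sub_const z0
  set U : Set ℂ := (fun x => z0 + x) ⁻¹' V with hUdef
  have hUo : IsOpen U := hVo.preimage (by fun_prop)
  have h0U : (0 : ℂ) ∈ U := by
    show z0 + 0 ∈ V
    rw [add_zero]; exact ⟨h0, hf0⟩
  have hFan : AnalyticAt ℂ F 0 := by
    refine DifferentiableOn.analyticAt (s := U) (fun x hx => ?_) (hUo.mem_nhds h0U)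
    exact (hFd x hx).differentiableAt.differentiableWithinAt
  have hFne : ¬ ∀ᶠ x in 𝓝 0, F x = x := by
    intro h
    refine QQ_ne_id hn z hz m hm g c hg z0 h0 hf0 ?_
    have ht : Tendsto (fun x => x - z0) (𝓝 z0) (𝓝 0) := by
      have : ContinuousAt (fun x => x - z0) z0 := by fun_prop
      simpa using this.tendsto
    filter_upwards [ht.eventually h] with x hx
    simpa [F] using hx
  obtain ⟨P, hPU, hPm, hPt, w, hwP, s, hs, hw⟩ := petal F hFan (by simp [F, hfix])
    (by
      rw [(hFd 0 h0U).deriv, add_zero, hfix, mul_comm, Complex.mul_conj, Complex.normSq_eq_norm_sq,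
        hd]
      simp) hFne U (hUo.mem_nhds h0U)
  have hiter : ∀ x k, f^[2 * k] (z0 + x) = z0 + F^[k] x := by
    intro x k
    induction k with
    | zero => simp
    | succ k ih =>
      rw [show 2 * (k + 1) = (2 * k + 1) + 1 by ring, Function.iterate_succ_apply',
        Function.iterate_succ_apply', ih, Function.iterate_succ_apply']
      simp [F]
  have hiter1 : ∀ x k, f^[2 * k + 1] (z0 + x) = f (z0 + F^[k] x) := by
    intro x k
    rw [Function.iterate_succ_apply', hiter]
  have hPk : ∀ x ∈ P, ∀ k, F^[k] x ∈ P := fun x hx k => hPm.iterate k hx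
  have hbas : ∀ x ∈ P, z0 + x ∈ basin z m g c (𝓝 z0) := by
    intro x hx
    have e1 : Tendsto (fun k => z0 + F^[k] x) atTop (𝓝 z0) := by
      simpa using (hPt x hx).const_add z0
    have e2 : Tendsto (fun k => f (z0 + F^[k] x)) atTop (𝓝 z0) := by
      have := (ff_continuousAt z m g c h0).tendsto.comp e1
      rw [← hf, hfix] at this
      exact this
    refine ⟨fun k => ?_, ?_⟩
    · rcases Nat.even_or_odd' k with ⟨i, rfl | rfl⟩
      · rw [← hf, hiter]; exact (hPU (hPk x hx i)).1
      · rw [← hf, hiter1]; exact (hPU (hPk x hx i)).2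
    · rw [Metric.tendsto_atTop] at e1 e2 ⊢
      intro ε hε
      obtain ⟨N1, hN1⟩ := e1 ε hε
      obtain ⟨N2, hN2⟩ := e2 ε hε
      refine ⟨2 * (N1 + N2), fun k hk => ?_⟩
      rcases Nat.even_or_odd' k with ⟨i, rfl | rfl⟩
      · rw [← hf, hiter]; exact hN1 i (by omega)
      · rw [← hf, hiter1]; exact hN2 i (by omega)
  have hballs : ∀ k, ball (z0 + F^[k] w) (s * ‖F^[k] w‖) ⊆ basin z m g c (𝓝 z0) := by
    intro k x hx
    have : x - z0 ∈ P := (hw k).2.1 (by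
      rw [mem_ball_iff_norm] at hx ⊢
      rwa [show x - z0 - F^[k] w = x - (z0 + F^[k] w) by ring])
    simpa using hbas _ this
  have hpos : ∀ k, 0 < ‖F^[k] w‖ := fun k => norm_pos_iff.2 (hw k).1
  refine ⟨⟨_, _, mul_pos hs (hpos 0), hballs 0⟩, fun p δ hδ hdis => ?_⟩
  by_contra hcon
  push Not at hcon
  set Pi : ℕ → ℝ := fun k => ∏ j ∈ Finset.range (2 * k), ‖dr z m g (f^[j] (z0 + w))‖ with hPi
  have hPi1 : ∀ k, Pi (k + 1) = Pi k * ‖deriv F (F^[k] w)‖ := by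
    intro k
    simp only [hPi]
    rw [show 2 * (k + 1) = (2 * k + 1) + 1 by ring, Finset.prod_range_succ, Finset.prod_range_succ,
      hiter, hiter1, (hFd _ (hPU (hPk w hwP k))).deriv, norm_mul, Complex.norm_conj]
    ring
  have hPi2 : ∀ k, Pi k ^ 2 * ‖w‖ ^ 3 ≤ ‖F^[k] w‖ ^ 3 := by
    intro k
    induction k with
    | zero => simp [hPi]
    | succ k ih =>
      rw [hPi1]
      refine le_trans ?_ (hw k).2.2
      nlinarith [sq_nonneg ‖deriv F (F^[k] w)‖]
  set C := 2 / δ * ‖z0 + w - p‖ ^ 2 with hC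
  have hk : ∀ k, s * ‖F^[k] w‖ ≤ Pi k * C := by
    intro k
    have := key_bound z hz m hm g c hg (𝓝 z0) hcon p δ hδ hdis (z0 + w) (hbas w hwP) (2 * k)
      (s * ‖F^[k] w‖) (mul_pos hs (hpos k)) (z0 + F^[k] w) id differentiableOn_id (hballs k)
      (by rw [← hf, hiter]; rfl)
    simpa using this
  have hk2 : ∀ k, s ^ 2 * ‖w‖ ^ 3 ≤ C ^ 2 * ‖F^[k] w‖ := by
    intro k
    have e1 := hk k
    have e2 := hPi2 k
    have e0 := hpos k
    have hpi0 : 0 ≤ Pi k := Finset.prod_nonneg fun _ _ => norm_nonneg _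
    have e3 : (s * ‖F^[k] w‖) ^ 2 ≤ (Pi k * C) ^ 2 := by
      apply pow_le_pow_left₀ (by positivity) e1
    have e4 : (s * ‖F^[k] w‖) ^ 2 * ‖w‖ ^ 3 ≤ C ^ 2 * ‖F^[k] w‖ ^ 3 := by
      calc (s * ‖F^[k] w‖) ^ 2 * ‖w‖ ^ 3 ≤ (Pi k * C) ^ 2 * ‖w‖ ^ 3 := by gcongr
        _ = C ^ 2 * (Pi k ^ 2 * ‖w‖ ^ 3) := by ring
        _ ≤ _ := by gcongr
    have e5 : ‖F^[k] w‖ ^ 2 * (s ^ 2 * ‖w‖ ^ 3) ≤ ‖F^[k] w‖ ^ 2 * (C ^ 2 * ‖F^[k] w‖) := by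
      linarith
    exact le_of_mul_le_mul_left e5 (by positivity)
  have ht : Tendsto (fun k => C ^ 2 * ‖F^[k] w‖) atTop (𝓝 0) := by
    simpa using (hPt w hwP).norm.const_mul (C ^ 2)
  have := ge_of_tendsto' ht hk2
  have h3 : 0 < ‖w‖ := hpos 0
  have : 0 < s ^ 2 * ‖w‖ ^ 3 := by positivity
  linarith

end KN
end

section
open Set Filter Topology Metric Complex
namespace KN

theorem tendsto_inv_sub_cocompact (a : ℂ) :
    Tendsto (fun x : ℂ => (x - a)⁻¹) (cocompact ℂ) (𝓝 0) := by
  have h1 : Tendsto (fun x : ℂ => x - a) (cocompact ℂ) (cocompact ℂ) := by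
    simpa [sub_eq_add_neg] using (Homeomorph.addRight (-a)).isClosedEmbedding.tendsto_cocompact
  rw [← Metric.cobounded_eq_cocompact] at h1 ⊢
  exact tendsto_inv₀_cobounded.comp h1

theorem tendsto_dr_cocompact {n : ℕ} (z : Fin n → ℂ) (m : Fin n → ℝ) (g : ℂ) :
    Tendsto (dr z m g) (cocompact ℂ) (𝓝 g) := by
  have h : Tendsto (fun x => ∑ j, (m j : ℂ) / (x - z j) ^ 2) (cocompact ℂ)
      (𝓝 (∑ j : Fin n, 0)) := by
    refine tendsto_finsetSum _ fun j _ => ?_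
    have := ((tendsto_inv_sub_cocompact (z j)).pow 2).const_mul (m j : ℂ)
    simpa [div_eq_mul_inv] using this
  have h2 := h.const_sub g
  rw [Finset.sum_const_zero, sub_zero] at h2
  exact h2

theorem ev_Om {n : ℕ} (z : Fin n → ℂ) : ∀ᶠ x in cocompact ℂ, x ∈ Om z := by
  have : ∀ᶠ x in cocompact ℂ, ∀ j, x ≠ z j := by
    rw [eventually_all]
    intro j
    exact (isCompact_singleton (x := z j)).compl_mem_cocompact
  exact this

theorem exists_radius {p : ℂ → Prop} (h : ∀ᶠ x in cocompact ℂ, p x) :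
    ∃ R : ℝ, ∀ x, R ≤ ‖x‖ → p x := by
  rw [← Metric.cobounded_eq_cocompact, ← comap_norm_atTop, eventually_comap, eventually_atTop] at h
  obtain ⟨R, hR⟩ := h
  exact ⟨R, fun x hx => hR _ hx x rfl⟩

theorem ev_err {n : ℕ} (z : Fin n → ℂ) (m : Fin n → ℝ) (g c : ℂ) :
    ∀ᶠ x in cocompact ℂ, ‖dr z m g x * x - rr z m g c x‖ ≤ ‖c‖ + 1 := by
  have h : Tendsto (fun x => ∑ j, (m j : ℂ) * ((x - z j)⁻¹ + z j * ((x - z j)⁻¹) ^ 2)) (cocompact ℂ)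
      (𝓝 (∑ j : Fin n, 0)) := by
    refine tendsto_finsetSum _ fun j _ => ?_
    have h1 := tendsto_inv_sub_cocompact (z j)
    have := (h1.add ((h1.pow 2).const_mul (z j))).const_mul (m j : ℂ)
    simpa using this
  have h2 := ((h.add (tendsto_sum_cocompact z m)).add_const c).norm
  simp only [Finset.sum_const_zero, add_zero, zero_add] at h2
  filter_upwards [h2.eventually_le_const (show ‖c‖ < ‖c‖ + 1 by linarith), ev_Om z] with x hx hO
  refine le_trans (le_of_eq ?_) hx
  rw [← norm_neg]
  congr 1
  have : ∑ j, (m j : ℂ) * ((x - z j)⁻¹ + z j * ((x - z j)⁻¹) ^ 2) =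
      (∑ j, (m j : ℂ) / (x - z j) ^ 2) * x := by
    rw [Finset.sum_mul]
    refine Finset.sum_congr rfl fun j _ => ?_
    have := sub_ne_zero.2 (hO j)
    field_simp
    ring
  rw [this]
  simp only [dr, rr]
  ring

theorem good_inf {n : ℕ} (z : Fin n → ℂ) (hz : Function.Injective z)
    (m : Fin n → ℝ) (hm : ∀ j, 0 < m j) (g c : ℂ) (hg : g ≠ 0) (hg1 : 1 < ‖g‖) :
    good z m g c (cocompact ℂ) := by
  obtain ⟨q, hq1, hq2⟩ := exists_between hg1
  obtain ⟨C, hC0, hCe⟩ : ∃ C : ℝ, 0 ≤ C ∧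
      ∀ᶠ x in cocompact ℂ, ‖dr z m g x * x - rr z m g c x‖ ≤ C :=
    ⟨‖c‖ + 1, by positivity, ev_err z m g c⟩
  set D := C / (q - 1) with hD
  have hq1' : 0 < q - 1 := by linarith
  have hD0 : 0 ≤ D := by positivity
  have hCD : C + D = D * q := by rw [hD]; field_simp; ring
  have e1 : ∀ᶠ x in cocompact ℂ, q < ‖dr z m g x‖ :=
    (tendsto_dr_cocompact z m g).norm.eventually_const_lt hq2
  have e2 : ∀ᶠ x in cocompact ℂ, q * ‖x‖ ≤ ‖ff z m g c x‖ := by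
    have h1 : ∀ᶠ x in cocompact ℂ, ‖c + ∑ j, (m j : ℂ) / (x - z j)‖ < ‖c + 0‖ + 1 :=
      ((tendsto_sum_cocompact z m).const_add c).norm.eventually_lt_const (by linarith)
    have h2 : ∀ᶠ x : ℂ in cocompact ℂ, (‖c + 0‖ + 1) / (‖g‖ - q) ≤ ‖x‖ :=
      tendsto_norm_cocompact_atTop.eventually_ge_atTop _
    filter_upwards [h1, h2] with x h1 h2
    rw [norm_ff]
    have h3 : rr z m g c x = g * x + (c + ∑ j, (m j : ℂ) / (x - z j)) := by
      simp only [rr]; ring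
    rw [h3]
    have h4 := norm_sub_le_norm_add (g * x) (c + ∑ j, (m j : ℂ) / (x - z j))
    rw [norm_mul] at h4
    rw [div_le_iff₀ (by linarith)] at h2
    linarith
  obtain ⟨R0, hR0⟩ := exists_radius ((ev_Om z).and (hCe.and (e1.and e2)))
  set R := max R0 (D + 1) with hR
  have hRR : R0 ≤ R := le_max_left _ _
  have hRD : D + 1 ≤ R := le_max_right _ _
  have hR1 : 0 < R := by linarith
  have hit : ∀ x, R ≤ ‖x‖ → ∀ k, q ^ k * ‖x‖ ≤ ‖(ff z m g c)^[k] x‖ := by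
    intro x hx k
    induction k with
    | zero => simp
    | succ k ih =>
      rw [Function.iterate_succ_apply']
      have h1 : ‖x‖ ≤ q ^ k * ‖x‖ := le_mul_of_one_le_left (norm_nonneg _) (one_le_pow₀ hq1.le)
      have h2 := (hR0 ((ff z m g c)^[k] x) (by linarith)).2.2.2
      refine le_trans ?_ h2
      rw [pow_succ', mul_assoc]
      exact mul_le_mul_of_nonneg_left ih (by linarith)
  have hit2 : ∀ x, R ≤ ‖x‖ → ∀ k, ‖x‖ ≤ ‖(ff z m g c)^[k] x‖ := fun x hx k =>
    (le_mul_of_one_le_left (norm_nonneg _) (one_le_pow₀ hq1.le)).trans (hit x hx k)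
  have hnt : ∀ x, R ≤ ‖x‖ → Tendsto (fun k => ‖(ff z m g c)^[k] x‖) atTop atTop := by
    intro x hx
    refine tendsto_atTop_mono (hit x hx) ?_
    exact (tendsto_pow_atTop_atTop_of_one_lt hq1).atTop_mul_const (by linarith)
  have hbas : ∀ x, R ≤ ‖x‖ → x ∈ basin z m g c (cocompact ℂ) := by
    intro x hx
    refine ⟨fun k => (hR0 _ ?_).1, ?_⟩
    · have := hit2 x hx k; linarith
    · rw [← Metric.cobounded_eq_cocompact, ← tendsto_norm_atTop_iff_cobounded]
      exact hnt x hx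
  set w : ℂ := ((R + 1 : ℝ) : ℂ) with hw
  have hwn : ‖w‖ = R + 1 := by
    rw [hw, Complex.norm_real, Real.norm_eq_abs, abs_of_pos (by linarith)]
  refine ⟨⟨w, 1, one_pos, fun x hx => hbas x ?_⟩, fun p δ hδ hdis => ?_⟩
  · rw [mem_ball_iff_norm] at hx
    have := norm_sub_norm_le w x
    rw [norm_sub_rev] at this
    linarith
  by_contra hcon
  push Not at hcon
  have hwR : R ≤ ‖w‖ := by linarith
  set f := ff z m g c with hf
  set Pi : ℕ → ℝ := fun k => ∏ j ∈ Finset.range k, ‖dr z m g (f^[j] w)‖ with hPi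
  have hPi2 : ∀ k, Pi k * (‖w‖ - D) ≤ ‖f^[k] w‖ - D := by
    intro k
    induction k with
    | zero => simp [hPi]
    | succ k ih =>
      have h1 := hit2 w hwR k
      obtain ⟨-, h2, h3, -⟩ := hR0 (f^[k] w) (by linarith)
      have h4 : Pi (k + 1) = Pi k * ‖dr z m g (f^[k] w)‖ := by
        simp only [hPi, Finset.prod_range_succ]
      rw [h4, Function.iterate_succ_apply', hf, norm_ff, ← hf]
      have h5 := norm_le_norm_add_norm_sub' (dr z m g (f^[k] w) * f^[k] w) (rr z m g c (f^[k] w))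
      rw [norm_mul] at h5
      have h6 := mul_le_mul_of_nonneg_right ih (norm_nonneg (dr z m g (f^[k] w)))
      have h7 := mul_le_mul_of_nonneg_left h3.le hD0
      linarith
  set C2 := 2 / δ * ‖w - p‖ ^ 2 with hC2
  have hC20 : 0 ≤ C2 := by positivity
  have hk : ∀ k, Real.log ‖f^[k] w‖ - Real.log R ≤ C2 := by
    intro k
    have h1 := hit2 w hwR k
    have hwk : 0 < ‖f^[k] w‖ := by linarith
    have hρ : 0 < Real.log ‖f^[k] w‖ - Real.log R :=
      sub_pos.2 (Real.log_lt_log hR1 (by linarith))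
    have := key_bound z hz m hm g c hg (cocompact ℂ) hcon p δ hδ hdis w (hbas w hwR) k
      _ hρ (Complex.log (f^[k] w)) Complex.exp Complex.differentiable_exp.differentiableOn
      (fun x hx => hbas _ (by
        rw [mem_ball_iff_norm] at hx
        have h2 := (Complex.abs_re_le_norm _).trans_lt hx
        rw [Complex.sub_re, Complex.log_re] at h2
        have h3 := (abs_lt.1 h2).1
        rw [Complex.norm_exp, ← Real.log_le_iff_le_exp hR1]
        linarith)) (Complex.exp_log (norm_pos_iff.1 hwk))
    rw [Complex.deriv_exp, Complex.exp_log (norm_pos_iff.1 hwk)] at this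
    have h3 := hPi2 k
    have hpi0 : 0 ≤ Pi k := Finset.prod_nonneg fun _ _ => norm_nonneg _
    have h4 : Pi k ≤ ‖f^[k] w‖ := by nlinarith
    have h5 : ‖f^[k] w‖ * (Real.log ‖f^[k] w‖ - Real.log R) ≤ ‖f^[k] w‖ * C2 :=
      this.trans (mul_le_mul_of_nonneg_right h4 hC20)
    exact le_of_mul_le_mul_left h5 hwk
  have ht := Real.tendsto_log_atTop.comp (hnt w hwR)
  obtain ⟨k, hk'⟩ := (ht.eventually_gt_atTop (C2 + Real.log R)).exists
  have := hk k
  simp only [Function.comp_apply] at hk'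
  linarith

/-- counting of attractors -/
theorem card_good {n : ℕ} (hn : 2 ≤ n) (z : Fin n → ℂ) (hz : Function.Injective z)
    (m : Fin n → ℝ) (hm : ∀ j, 0 < m j) (g c : ℂ) {ι : Type*} (S : Finset ι) (l : ι → Filter ℂ)
    (hgood : ∀ i ∈ S, good z m g c (l i)) (hdis : ∀ i ∈ S, ∀ j ∈ S, i ≠ j → Disjoint (l i) (l j)) :
    S.card ≤ 2 * n := by
  classical
  by_cases hS : S.card ≤ 1
  · omega
  rw [not_le, Finset.one_lt_card] at hS
  have hex : ∀ i ∈ S, ∃ w ∈ basin z m g c (l i), dr z m g w = 0 := by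
    intro i hi
    obtain ⟨j, hj, hij⟩ : ∃ j ∈ S, i ≠ j := by
      obtain ⟨a, ha, b, hb, hab⟩ := hS
      by_cases h : i = a
      · exact ⟨b, hb, by rwa [h]⟩
      · exact ⟨a, ha, h⟩
    obtain ⟨p, δ, hδ, hb⟩ := (hgood j hj).1
    exact (hgood i hi).2 p δ hδ ((basin_disj z m g c (hdis i hi j hj hij)).symm.mono_left hb)
  choose! w hw1 hw2 using hex
  obtain ⟨hf, hc⟩ := crit_finite hn z hz m hm g
  have hinj : Set.InjOn w S := by
    intro i hi j hj hij
    by_contra hne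
    have := basin_disj z m g c (hdis i hi j hj hne)
    exact Set.disjoint_left.1 this (hw1 i hi) (hij ▸ hw1 j hj)
  have : (w '' S).ncard ≤ 2 * n := by
    refine (Set.ncard_le_ncard ?_ hf).trans hc
    rintro _ ⟨i, hi, rfl⟩
    exact ⟨basin_sub z m g c _ (hw1 i hi), hw2 i hi⟩
  rwa [Set.InjOn.ncard_image hinj, Set.ncard_coe_finset] at this

/-- Part A -/
theorem partA {n : ℕ} (hn : 2 ≤ n) (z : Fin n → ℂ) (hz : Function.Injective z)
    (m : Fin n → ℝ) (hm : ∀ j, 0 < m j) (g c : ℂ) (hg : g ≠ 0) (S : Finset ℂ)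
    (hS : ∀ x ∈ S, x ∈ Om z ∧ ff z m g c x = x ∧ ‖dr z m g x‖ ≤ 1) :
    S.card ≤ 2 * n ∧ (1 < ‖g‖ → S.card + 1 ≤ 2 * n) := by
  have hgood : ∀ x ∈ S, good z m g c (𝓝 x) := by
    intro x hx
    obtain ⟨h1, h2, h3⟩ := hS x hx
    rcases h3.lt_or_eq with h | h
    · exact good_attr z hz m hm g c hg x h1 h2 h
    · exact good_neutral hn z hz m hm g c hg x h1 h2 h
  refine ⟨card_good hn z hz m hm g c S (fun x => 𝓝 x) hgood fun i _ j _ hij =>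
    disjoint_nhds_nhds.2 hij, fun hg1 => ?_⟩
  have := card_good hn z hz m hm g c (Finset.insertNone S)
    (fun o => o.elim (cocompact ℂ) (fun x => 𝓝 x)) ?_ ?_
  · simpa using this
  · rintro (_ | x) hx
    · exact good_inf z hz m hm g c hg hg1
    · exact hgood x (by simpa using hx)
  · rintro (_ | x) hx (_ | y) hy hxy
    · exact absurd rfl hxy
    · exact (disjoint_nhds_cocompact y).symm
    · exact disjoint_nhds_cocompact x
    · exact disjoint_nhds_nhds.2 fun h => hxy (by rw [h])

end KN
end

section
open Set Filter Topology Metric Complex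
namespace KN

/-- the (unshifted) lensing map -/
noncomputable def HH {n : ℕ} (z : Fin n → ℂ) (m : Fin n → ℝ) (g x : ℂ) : ℂ :=
  x - ff z m g 0 x

/-- its real derivative -/
noncomputable def LL (d : ℂ) : ℂ →L[ℝ] ℂ :=
  ContinuousLinearMap.id ℝ ℂ - (conjCLE : ℂ →L[ℝ] ℂ).comp (ContinuousLinearMap.mul ℝ ℂ d)

theorem LL_apply (d h : ℂ) : LL d h = h - (starRingEnd ℂ) (d * h) := by
  simp [LL]

theorem LL_adj (d v : ℂ) : LL d (v + (starRingEnd ℂ) d * (starRingEnd ℂ) v)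
    = ((1 - ‖d‖ ^ 2 : ℝ) : ℂ) * v := by
  have h : d * (starRingEnd ℂ) d = ((‖d‖ ^ 2 : ℝ) : ℂ) := by
    rw [Complex.mul_conj, Complex.normSq_eq_norm_sq]
  rw [LL_apply]
  simp only [map_mul, map_add, Complex.conj_conj]
  push_cast at h ⊢
  rw [← h]
  ring

theorem LL_det (d : ℂ) : (LL d).det = 1 - ‖d‖ ^ 2 := by
  have h := LinearMap.det_toMatrix Complex.basisOneI (LL d : ℂ →ₗ[ℝ] ℂ)
  rw [ContinuousLinearMap.det, ← h, Matrix.det_fin_two, LinearMap.toMatrix_apply,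
    LinearMap.toMatrix_apply, LinearMap.toMatrix_apply, LinearMap.toMatrix_apply]
  simp only [Complex.coe_basisOneI_repr, Complex.coe_basisOneI, Matrix.cons_val_zero,
    Matrix.cons_val_one, ContinuousLinearMap.coe_coe, LL_apply]
  rw [Complex.sq_norm, Complex.normSq_apply]
  simp
  ring

theorem LL_range (d : ℂ) (hd : ‖d‖ ≠ 1) : (LL d).range = ⊤ := by
  rw [LinearMap.range_eq_top]
  intro v
  have hJ : (1 - ‖d‖ ^ 2 : ℝ) ≠ 0 := by
    intro h
    apply hd
    nlinarith [norm_nonneg d]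
  refine ⟨(1 - ‖d‖ ^ 2 : ℝ)⁻¹ • (v + (starRingEnd ℂ) d * (starRingEnd ℂ) v), ?_⟩
  show LL d _ = v
  rw [map_smul, LL_adj, Complex.real_smul, ← mul_assoc, ← Complex.ofReal_mul, inv_mul_cancel₀ hJ]
  simp

theorem LL_lower (d h : ℂ) : |1 - ‖d‖| * ‖h‖ ≤ ‖LL d h‖ := by
  rw [LL_apply]
  have := abs_norm_sub_norm_le h ((starRingEnd ℂ) (d * h))
  rw [Complex.norm_conj, norm_mul] at this
  rwa [show ‖h‖ - ‖d‖ * ‖h‖ = (1 - ‖d‖) * ‖h‖ by ring, abs_mul, abs_norm] at this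

theorem ff_eq {n : ℕ} (z : Fin n → ℂ) (m : Fin n → ℝ) (g c x : ℂ) :
    ff z m g c x = (starRingEnd ℂ) c + ff z m g 0 x := by
  simp [ff, rr, add_assoc]

theorem fix_iff {n : ℕ} (z : Fin n → ℂ) (m : Fin n → ℝ) (g c x : ℂ) :
    ff z m g c x = x ↔ HH z m g x = (starRingEnd ℂ) c := by
  rw [ff_eq, HH, sub_eq_iff_eq_add, eq_comm]

theorem hasStrictFDerivAt_HH {n : ℕ} (z : Fin n → ℂ) (m : Fin n → ℝ) (g : ℂ) {x : ℂ}
    (hx : x ∈ Om z) : HasStrictFDerivAt (HH z m g) (LL (dr z m g x)) x := by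
  have h1 : HasStrictFDerivAt (rr z m g 0)
      (ContinuousLinearMap.mul ℝ ℂ (dr z m g x)) x := by
    have := (hasStrictDerivAt_rr z m g 0 hx).hasStrictFDerivAt.restrictScalars ℝ
    refine this.congr_fderiv ?_
    ext y
    simp [mul_comm]
  have h2 := (conjCLE : ℂ →L[ℝ] ℂ).hasStrictFDerivAt.comp x h1
  exact (hasStrictFDerivAt_id (𝕜 := ℝ) x).sub h2

theorem HH_inj_nhds {n : ℕ} (z : Fin n → ℂ) (m : Fin n → ℝ) (g : ℂ) {x : ℂ}
    (hx : x ∈ Om z) (hd : ‖dr z m g x‖ ≠ 1) :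
    ∃ U, IsOpen U ∧ x ∈ U ∧ InjOn (HH z m g) U := by
  have hpos : 0 < |1 - ‖dr z m g x‖| := abs_pos.2 (sub_ne_zero.2 (Ne.symm hd))
  have h1 := (hasStrictFDerivAt_HH z m g hx).isLittleO.def (half_pos hpos)
  rw [nhds_prod_eq] at h1
  obtain ⟨t, ht, h⟩ := eventually_prod_self_iff'.1 h1
  obtain ⟨U, hU1, hU2, hU3⟩ := _root_.mem_nhds_iff.1 ht
  refine ⟨U, hU2, hU3, fun a ha b hb hab => ?_⟩
  have h2 := h a (hU1 ha) b (hU1 hb)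
  simp only [hab, sub_self, zero_sub, norm_neg] at h2
  have h3 := LL_lower (dr z m g x) (a - b)
  by_contra hne
  have : 0 < ‖a - b‖ := norm_pos_iff.2 (sub_ne_zero.2 hne)
  nlinarith

theorem HH_open {n : ℕ} (z : Fin n → ℂ) (m : Fin n → ℝ) (g : ℂ) {x : ℂ}
    (hx : x ∈ Om z) (hd : ‖dr z m g x‖ ≠ 1) : map (HH z m g) (𝓝 x) = 𝓝 (HH z m g x) :=
  (hasStrictFDerivAt_HH z m g hx).map_nhds_eq_of_surj (LL_range _ hd)

theorem continuousOn_HH {n : ℕ} (z : Fin n → ℂ) (m : Fin n → ℝ) (g : ℂ) :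
    ContinuousOn (HH z m g) (Om z) := fun _ hx =>
  (hasStrictFDerivAt_HH z m g hx).hasFDerivAt.continuousAt.continuousWithinAt

theorem HH_formula {n : ℕ} (z : Fin n → ℂ) (m : Fin n → ℝ) (g x : ℂ) :
    HH z m g x = (x - (starRingEnd ℂ) (g * x)) - (starRingEnd ℂ) (∑ j, (m j : ℂ) / (x - z j)) := by
  simp only [HH, ff, rr, zero_add, map_add]
  ring

theorem tendsto_HH_pole {n : ℕ} (z : Fin n → ℂ) (hz : Function.Injective z) (m : Fin n → ℝ)
    (hm : ∀ j, 0 < m j) (g : ℂ) (j : Fin n) :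
    Tendsto (fun x => ‖HH z m g x‖) (𝓝[≠] (z j)) atTop := by
  have h1 : Tendsto (fun x => ‖-(starRingEnd ℂ) (∑ j, (m j : ℂ) / (x - z j))‖) (𝓝[≠] (z j)) atTop := by
    simp_rw [norm_neg, Complex.norm_conj]
    exact tendsto_sum_pole z hz m hm j
  have h2 : ContinuousAt (fun x => x - (starRingEnd ℂ) (g * x)) (z j) := by
    have := Complex.continuous_conj
    fun_prop
  have := tendsto_norm_add_of_continuousAt h1 (h2.tendsto.mono_left nhdsWithin_le_nhds)
  simpa only [HH_formula, sub_eq_add_neg] using this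

theorem tendsto_HH_cocompact {n : ℕ} (z : Fin n → ℂ) (m : Fin n → ℝ) (g : ℂ) (hg : ‖g‖ ≠ 1) :
    Tendsto (fun x => ‖HH z m g x‖) (cocompact ℂ) atTop := by
  have hpos : 0 < |1 - ‖g‖| := abs_pos.2 (sub_ne_zero.2 (Ne.symm hg))
  have h1 : Tendsto (fun x => ‖x - (starRingEnd ℂ) (g * x)‖) (cocompact ℂ) atTop := by
    refine tendsto_atTop_mono (fun x => ?_) (tendsto_norm_cocompact_atTop.const_mul_atTop hpos)
    rw [← LL_apply]
    exact LL_lower g x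
  have h2 : Tendsto (fun x => -(starRingEnd ℂ) (∑ j, (m j : ℂ) / (x - z j))) (cocompact ℂ)
      (𝓝 (-(starRingEnd ℂ) 0)) :=
    ((Complex.continuous_conj.tendsto 0).comp (tendsto_sum_cocompact z m)).neg
  have := tendsto_norm_add_of_continuousAt h1 h2
  refine this.congr fun x => ?_
  rw [HH_formula]; congr 1; ring

theorem isCompact_HH_preim {n : ℕ} (z : Fin n → ℂ) (hz : Function.Injective z) (m : Fin n → ℝ)
    (hm : ∀ j, 0 < m j) (g : ℂ) (hg : ‖g‖ ≠ 1) {K : Set ℂ} (hK : IsCompact K) :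
    IsCompact {x | x ∈ Om z ∧ HH z m g x ∈ K} :=
  isCompact_preim z _ (continuousOn_HH z m g) (tendsto_HH_pole z hz m hm g)
    (tendsto_HH_cocompact z m g hg) hK

theorem contDiffAt_HH {n : ℕ} (z : Fin n → ℂ) (m : Fin n → ℝ) (g : ℂ) {x : ℂ}
    (hx : x ∈ Om z) : ContDiffAt ℝ 1 (HH z m g) x := by
  have h1 : ContDiffAt ℂ 1 (rr z m g 0) x :=
    ((differentiableOn_rr z m g 0).analyticAt ((isOpen_Om z).mem_nhds hx)).contDiffAt
  have h2 := h1.restrict_scalars ℝ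
  exact contDiffAt_id.sub ((conjCLE : ℂ →L[ℝ] ℂ).contDiff.contDiffAt.comp x h2)

theorem differentiableOn_dr {n : ℕ} (z : Fin n → ℂ) (m : Fin n → ℝ) (g : ℂ) :
    DifferentiableOn ℂ (dr z m g) (Om z) := by
  have h : ∀ x ∈ Om z, dr z m g x = deriv (rr z m g 0) x := fun x hx =>
    (hasStrictDerivAt_rr z m g 0 hx).hasDerivAt.deriv.symm
  exact ((differentiableOn_rr z m g 0).deriv (isOpen_Om z)).congr h

end KN
end

section
open Set Filter Topology Metric Complex MeasureTheory
namespace KN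

theorem integral_fderiv_zero (f : ℂ → ℂ) (hf : ContDiff ℝ 1 f) (hc : HasCompactSupport f) (v : ℂ) :
    Integrable (fun x => fderiv ℝ f x v) ∧ ∫ x, fderiv ℝ f x v = 0 := by
  have hcont : Continuous (fun x => fderiv ℝ f x v) :=
    (hf.continuous_fderiv (by norm_num)).clm_apply continuous_const
  have hcs : HasCompactSupport (fun x => fderiv ℝ f x v) := hc.fderiv_apply ℝ v
  have hIntg : Integrable (fun x => fderiv ℝ f x v) := hcont.integrable_of_hasCompactSupport hcs
  refine ⟨hIntg, ?_⟩
  have hIntgB : Integrable f := hf.continuous.integrable_of_hasCompactSupport hc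
  have := integral_mul_fderiv_eq_neg_fderiv_mul_of_integrable (𝕜 := ℂ) (μ := volume)
    (f := fun _ : ℂ => (1 : ℂ)) (g := f) (v := v) (by simp) (by simpa using hIntg)
    (by simpa using hIntgB) (fun x _ => differentiableAt_const _)
    (fun x _ => (hf.differentiable (by norm_num)) x)
  simpa using this

/-- the degree integrand identity -/
theorem degree_identity {n : ℕ} (z : Fin n → ℂ) (hz : Function.Injective z) (m : Fin n → ℝ)
    (hm : ∀ j, 0 < m j) (g : ℂ) (hg : ‖g‖ ≠ 1) (ψ : ℂ → ℝ) (hψ : ContDiff ℝ 1 ψ)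
    (hψc : HasCompactSupport ψ) :
    ∫ x in Om z, fderiv ℝ ψ (HH z m g x) 1 * (1 - ‖dr z m g x‖ ^ 2) = 0 := by
  classical
  set K : Set ℂ := {x | x ∈ Om z ∧ HH z m g x ∈ tsupport ψ} with hK
  have hKc : IsCompact K := isCompact_HH_preim z hz m hm g hg hψc
  let f : ℂ → ℂ := (Om z).indicator fun x => (ψ (HH z m g x) : ℂ) * (1 + dr z m g x)
  have hf0 : ∀ x ∉ K, f x = 0 := by
    intro x hx
    by_cases hxO : x ∈ Om z
    · have : HH z m g x ∉ tsupport ψ := fun h => hx ⟨hxO, h⟩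
      simp [f, hxO, image_eq_zero_of_notMem_tsupport this]
    · simp [f, hxO]
  have hfc : HasCompactSupport f := HasCompactSupport.intro hKc hf0
  have hfev : ∀ x ∈ Om z, f =ᶠ[𝓝 x] fun x => (ψ (HH z m g x) : ℂ) * (1 + dr z m g x) := by
    intro x hx
    filter_upwards [(isOpen_Om z).mem_nhds hx] with y hy
    simp [f, hy]
  have hdrC : ∀ x ∈ Om z, ContDiffAt ℝ 1 (dr z m g) x := fun x hx => by
    have h1 : ContDiffAt ℂ 1 (dr z m g) x :=
      ((differentiableOn_dr z m g).analyticAt ((isOpen_Om z).mem_nhds hx)).contDiffAt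
    exact h1.restrict_scalars ℝ
  have hfC : ContDiff ℝ 1 f := by
    rw [contDiff_iff_contDiffAt]
    intro x
    by_cases hx : x ∈ Om z
    · refine ContDiffAt.congr_of_eventuallyEq ?_ (hfev x hx)
      have h1 : ContDiffAt ℝ 1 (fun x => ψ (HH z m g x)) x :=
        hψ.contDiffAt.comp x (contDiffAt_HH z m g hx)
      have h2 : ContDiffAt ℝ 1 (fun x => (ψ (HH z m g x) : ℂ)) x :=
        Complex.ofRealCLM.contDiff.contDiffAt.comp x h1
      exact h2.mul (contDiffAt_const.add (hdrC x hx))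
    · have hxK : x ∉ K := fun h => hx h.1
      have : f =ᶠ[𝓝 x] fun _ => 0 := by
        filter_upwards [hKc.isClosed.isOpen_compl.mem_nhds hxK] with y hy using hf0 y hy
      exact contDiffAt_const.congr_of_eventuallyEq this
  have hfd : ∀ x ∈ Om z, ∃ d' : ℂ, ∀ h, fderiv ℝ f x h =
      (ψ (HH z m g x) : ℂ) * (d' * h) +
        (fderiv ℝ ψ (HH z m g x) (LL (dr z m g x) h) : ℂ) * (1 + dr z m g x) := by
    intro x hx
    refine ⟨deriv (dr z m g) x, fun h => ?_⟩
    rw [(hfev x hx).fderiv_eq]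
    have h1 : HasFDerivAt (fun x => ψ (HH z m g x))
        ((fderiv ℝ ψ (HH z m g x)).comp (LL (dr z m g x))) x :=
      ((hψ.differentiable (by norm_num)) _).hasFDerivAt.comp x
        (hasStrictFDerivAt_HH z m g hx).hasFDerivAt
    have h2 : HasFDerivAt (fun x => (ψ (HH z m g x) : ℂ)) _ x :=
      Complex.ofRealCLM.hasFDerivAt.comp x h1
    have h3 : HasFDerivAt (dr z m g) _ x :=
      (((differentiableOn_dr z m g).differentiableAt
        ((isOpen_Om z).mem_nhds hx)).hasDerivAt.hasFDerivAt.restrictScalars ℝ)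
    have h4 : HasFDerivAt (fun x => (ψ (HH z m g x) : ℂ) * (1 + dr z m g x)) _ x :=
      h2.mul (h3.const_add 1)
    rw [h4.fderiv]
    simp
    ring
  have hre : ∀ x ∈ Om z, fderiv ℝ ψ (HH z m g x) 1 * (1 - ‖dr z m g x‖ ^ 2) =
      (fderiv ℝ f x 1 + I * fderiv ℝ f x I).re := by
    intro x hx
    obtain ⟨d', hd'⟩ := hfd x hx
    rw [hd', hd']
    set d := dr z m g x with hd
    set D := fderiv ℝ ψ (HH z m g x) with hD
    have e1 : ((ψ (HH z m g x) : ℂ) * (d' * 1) + (D (LL d 1) : ℂ) * (1 + d) +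
        I * ((ψ (HH z m g x) : ℂ) * (d' * I) + (D (LL d I) : ℂ) * (1 + d))) =
        ((D (LL d 1) : ℂ) + I * (D (LL d I) : ℂ)) * (1 + d) := by
      linear_combination (ψ (HH z m g x) : ℂ) * d' * Complex.I_mul_I
    rw [e1]
    have e2 := LL_adj d 1
    rw [map_one, mul_one, mul_one] at e2
    have e3 : (1 + (starRingEnd ℂ) d) = (1 + d.re) • (1 : ℂ) + (-d.im) • I := by
      apply Complex.ext <;> simp
    have e4 : D (LL d (1 + (starRingEnd ℂ) d)) = (1 + d.re) * D (LL d 1) - d.im * D (LL d I) := by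
      rw [e3, map_add, map_smul, map_smul, map_add, map_smul, map_smul]
      simp only [smul_eq_mul]; ring
    rw [e2] at e4
    have e5 : D (((1 - ‖d‖ ^ 2 : ℝ) : ℂ)) = (1 - ‖d‖ ^ 2) * D 1 := by
      rw [← smul_eq_mul, ← map_smul]
      congr 1
      simp
    rw [e5] at e4
    rw [mul_comm, e4]
    simp
    ring
  rw [setIntegral_congr_fun (isOpen_Om z).measurableSet hre]
  have hcompl : ∀ x ∉ Om z, (fderiv ℝ f x 1 + I * fderiv ℝ f x I).re = 0 := by
    intro x hx
    have hxK : x ∉ K := fun h => hx h.1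
    have : f =ᶠ[𝓝 x] fun _ => 0 := by
      filter_upwards [hKc.isClosed.isOpen_compl.mem_nhds hxK] with y hy using hf0 y hy
    rw [this.fderiv_eq]
    simp
  rw [setIntegral_eq_integral_of_forall_compl_eq_zero hcompl]
  obtain ⟨i1, j1⟩ := integral_fderiv_zero f hfC hfc 1
  obtain ⟨i2, j2⟩ := integral_fderiv_zero f hfC hfc I
  have : ∫ x, (fderiv ℝ f x 1 + I * fderiv ℝ f x I) = 0 := by
    rw [integral_add i1 (i2.const_mul I), integral_const_mul, j1, j2]; simp
  have h3 := reCLM.integral_comp_comm (i1.add (i2.const_mul I))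
  simp only [Pi.add_apply, reCLM_apply] at h3
  rw [h3, this]
  simp

end KN
end

section
open Set Filter Topology Metric Complex MeasureTheory
namespace KN

theorem area_upper {n : ℕ} (z : Fin n → ℂ) (m : Fin n → ℝ) (g : ℂ) (A : Set ℂ)
    (hA : MeasurableSet A) (hAO : ∀ x ∈ A, x ∈ Om z ∧ ‖dr z m g x‖ ≠ 1) (φ : ℂ → ENNReal)
    (hφ : Measurable φ) (K : ℕ)
    (hK : ∀ w, φ w ≠ 0 → ∀ S : Finset ℂ, (∀ x ∈ S, x ∈ A ∧ HH z m g x = w) → S.card ≤ K) :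
    ∫⁻ x in A, ENNReal.ofReal |1 - ‖dr z m g x‖ ^ 2| * φ (HH z m g x) ≤ K * ∫⁻ w, φ w := by
  classical
  rcases A.eq_empty_or_nonempty with hAe | hAne
  · simp [hAe]
  have hU : ∀ x ∈ A, ∃ U, IsOpen U ∧ x ∈ U ∧ InjOn (HH z m g) U := fun x hx =>
    HH_inj_nhds z m g (hAO x hx).1 (hAO x hx).2
  choose! U hU1 hU2 hU3 using hU
  obtain ⟨t, htA, htc, htU⟩ := TopologicalSpace.countable_cover_nhdsWithin (f := U) (s := A)
    (fun x hx => mem_nhdsWithin_of_mem_nhds ((hU1 x hx).mem_nhds (hU2 x hx)))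
  have htne : t.Nonempty := by
    rcases t.eq_empty_or_nonempty with h | h
    · obtain ⟨x, hx⟩ := hAne
      have := htU hx
      simp [h] at this
    · exact h
  obtain ⟨e, he⟩ := htc.exists_eq_range htne
  have het : ∀ k, e k ∈ A := fun k => htA (by rw [he]; exact mem_range_self k)
  set V : ℕ → Set ℂ := fun k => U (e k) with hV
  set B : ℕ → Set ℂ := fun k => A ∩ disjointed V k with hB
  have hBm : ∀ k, MeasurableSet (B k) := fun k =>
    hA.inter (MeasurableSet.disjointed (fun i => (hU1 _ (het i)).measurableSet) k)
  have hBd : Pairwise (Function.onFun Disjoint B) := fun i j hij =>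
    (disjoint_disjointed V hij).mono inter_subset_right inter_subset_right
  have hBA : A = ⋃ k, B k := by
    rw [hB, ← inter_iUnion, iUnion_disjointed]
    refine (inter_eq_left.2 ?_).symm
    intro x hx
    have := htU hx
    simp only [mem_iUnion] at this ⊢
    obtain ⟨y, hy, hxy⟩ := this
    rw [he] at hy
    obtain ⟨k, rfl⟩ := hy
    exact ⟨k, hxy⟩
  have hinj : ∀ k, InjOn (HH z m g) (B k) := fun k =>
    (hU3 _ (het k)).mono (inter_subset_right.trans (disjointed_subset V k))
  have hder : ∀ k, ∀ x ∈ B k, HasFDerivWithinAt (HH z m g) (LL (dr z m g x)) (B k) x :=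
    fun k x hx => (hasStrictFDerivAt_HH z m g (hAO x hx.1).1).hasFDerivAt.hasFDerivWithinAt
  have himm : ∀ k, MeasurableSet (HH z m g '' B k) := fun k =>
    measurable_image_of_fderivWithin (hBm k) (hder k) (hinj k)
  conv_lhs => rw [hBA]
  rw [lintegral_iUnion hBm hBd]
  have hk : ∀ k, ∫⁻ x in B k, ENNReal.ofReal |1 - ‖dr z m g x‖ ^ 2| * φ (HH z m g x) =
      ∫⁻ w, (HH z m g '' B k).indicator φ w := by
    intro k
    rw [lintegral_indicator (himm k),
      lintegral_image_eq_lintegral_abs_det_fderiv_mul volume (hBm k) (hder k) (hinj k)]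
    simp only [LL_det]
  simp_rw [hk]
  rw [← lintegral_tsum (fun k => (hφ.indicator (himm k)).aemeasurable), ← lintegral_const_mul _ hφ]
  refine lintegral_mono fun w => ?_
  rw [ENNReal.tsum_eq_iSup_sum]
  refine iSup_le fun s => ?_
  by_cases hw : φ w = 0
  · refine le_of_eq_of_le (Finset.sum_eq_zero fun k _ => ?_) zero_le'
    by_cases h : w ∈ HH z m g '' B k <;> simp [h, hw]
  rw [show (∑ k ∈ s, (HH z m g '' B k).indicator φ w) =
    ∑ k ∈ s, if w ∈ HH z m g '' B k then φ w else 0 from rfl]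
  rw [← Finset.sum_filter, Finset.sum_const, nsmul_eq_mul]
  refine mul_le_mul_left ?_ _
  set s' := s.filter fun k => w ∈ HH z m g '' B k with hs'
  have hx : ∀ k ∈ s', ∃ x, x ∈ B k ∧ HH z m g x = w := by
    intro k hk
    obtain ⟨x, hx, hxw⟩ := (Finset.mem_filter.1 hk).2
    exact ⟨x, hx, hxw⟩
  choose! x hx1 hx2 using hx
  have hinj' : Set.InjOn x s' := by
    intro i hi j hj hij
    by_contra hne
    exact Set.disjoint_left.1 (hBd hne) (hx1 i hi) (hij ▸ hx1 j hj)
  have := hK w hw (s'.image x) (by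
    intro y hy
    obtain ⟨k, hk, rfl⟩ := Finset.mem_image.1 hy
    exact ⟨(hx1 k hk).1, hx2 k hk⟩)
  rw [Finset.card_image_of_injOn hinj'] at this
  exact_mod_cast this

theorem area_lower {n : ℕ} (z : Fin n → ℂ) (m : Fin n → ℝ) (g : ℂ) (A : Set ℂ)
    (hAO : ∀ x ∈ A, x ∈ Om z) (φ : ℂ → ENNReal)
    (S : Finset ℂ) (U : ℂ → Set ℂ) (hUo : ∀ x ∈ S, IsOpen (U x)) (hUA : ∀ x ∈ S, U x ⊆ A)
    (hUd : (S : Set ℂ).PairwiseDisjoint U) (hUi : ∀ x ∈ S, InjOn (HH z m g) (U x))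
    (hUφ : ∀ x ∈ S, ∀ w, φ w ≠ 0 → w ∈ HH z m g '' (U x)) :
    S.card * ∫⁻ w, φ w ≤ ∫⁻ x in A, ENNReal.ofReal |1 - ‖dr z m g x‖ ^ 2| * φ (HH z m g x) := by
  have hsub : (⋃ x ∈ S, U x) ⊆ A := iUnion₂_subset hUA
  refine le_trans ?_ (lintegral_mono_set hsub)
  rw [lintegral_biUnion_finset hUd (fun x hx => (hUo x hx).measurableSet)]
  have hk : ∀ y ∈ S, ∫⁻ x in U y, ENNReal.ofReal |1 - ‖dr z m g x‖ ^ 2| * φ (HH z m g x) =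
      ∫⁻ w, φ w := by
    intro y hy
    have hder : ∀ x ∈ U y, HasFDerivWithinAt (HH z m g) (LL (dr z m g x)) (U y) x :=
      fun x hx => (hasStrictFDerivAt_HH z m g (hAO x (hUA y hy hx))).hasFDerivAt.hasFDerivWithinAt
    have h1 := lintegral_image_eq_lintegral_abs_det_fderiv_mul volume (hUo y hy).measurableSet hder
      (hUi y hy) φ
    simp only [LL_det] at h1
    rw [← h1, ← lintegral_indicator (measurable_image_of_fderivWithin (hUo y hy).measurableSet hder
      (hUi y hy))]
    congr 1
    ext w
    by_cases hw : φ w = 0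
    · by_cases h : w ∈ HH z m g '' U y <;> simp [h, hw]
    · rw [Set.indicator_of_mem (hUφ y hy w hw)]
  rw [Finset.sum_congr rfl hk, Finset.sum_const, nsmul_eq_mul]

theorem split_int {n : ℕ} (z : Fin n → ℂ) (hz : Function.Injective z) (m : Fin n → ℝ)
    (hm : ∀ j, 0 < m j) (g : ℂ) (hg : ‖g‖ ≠ 1) (φ : ℂ → ℝ) (hφ : Continuous φ)
    (hφc : HasCompactSupport φ) (hφ0 : ∀ w, 0 ≤ φ w) :
    IntegrableOn (fun x => φ (HH z m g x) * (1 - ‖dr z m g x‖ ^ 2)) (Om z) ∧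
    (∫⁻ x in {x | x ∈ Om z ∧ ‖dr z m g x‖ < 1},
      ENNReal.ofReal |1 - ‖dr z m g x‖ ^ 2| * ENNReal.ofReal (φ (HH z m g x))) ≠ ⊤ ∧
    (∫⁻ x in {x | x ∈ Om z ∧ 1 < ‖dr z m g x‖},
      ENNReal.ofReal |1 - ‖dr z m g x‖ ^ 2| * ENNReal.ofReal (φ (HH z m g x))) ≠ ⊤ ∧
    ∫ x in Om z, φ (HH z m g x) * (1 - ‖dr z m g x‖ ^ 2) =
      (∫⁻ x in {x | x ∈ Om z ∧ ‖dr z m g x‖ < 1},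
        ENNReal.ofReal |1 - ‖dr z m g x‖ ^ 2| * ENNReal.ofReal (φ (HH z m g x))).toReal -
      (∫⁻ x in {x | x ∈ Om z ∧ 1 < ‖dr z m g x‖},
        ENNReal.ofReal |1 - ‖dr z m g x‖ ^ 2| * ENNReal.ofReal (φ (HH z m g x))).toReal := by
  classical
  set K : Set ℂ := {x | x ∈ Om z ∧ HH z m g x ∈ tsupport φ} with hK
  have hKc : IsCompact K := isCompact_HH_preim z hz m hm g hg hφc
  have hKO : K ⊆ Om z := fun x hx => hx.1
  have hcont : ContinuousOn (fun x => φ (HH z m g x) * (1 - ‖dr z m g x‖ ^ 2)) (Om z) := by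
    refine (hφ.comp_continuousOn (continuousOn_HH z m g)).mul ?_
    exact continuousOn_const.sub ((continuousOn_dr z m g).norm.pow 2)
  have hIntg : IntegrableOn (fun x => φ (HH z m g x) * (1 - ‖dr z m g x‖ ^ 2)) (Om z) := by
    refine IntegrableOn.of_forall_diff_eq_zero ((hcont.mono hKO).integrableOn_compact hKc)
      (isOpen_Om z).measurableSet ?_
    rintro x ⟨hx1, hx2⟩
    have : HH z m g x ∉ tsupport φ := fun h => hx2 ⟨hx1, h⟩
    simp [image_eq_zero_of_notMem_tsupport this]
  have hnormO : ContinuousOn (fun x => ‖dr z m g x‖) (Om z) := (continuousOn_dr z m g).norm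
  have hP : IsOpen {x | x ∈ Om z ∧ ‖dr z m g x‖ < 1} :=
    hnormO.isOpen_inter_preimage (isOpen_Om z) isOpen_Iio
  have hN : IsOpen {x | x ∈ Om z ∧ 1 < ‖dr z m g x‖} :=
    hnormO.isOpen_inter_preimage (isOpen_Om z) isOpen_Ioi
  have hO := (isOpen_Om z).measurableSet
  have eP : ∫⁻ x in Om z, ENNReal.ofReal (φ (HH z m g x) * (1 - ‖dr z m g x‖ ^ 2)) =
      ∫⁻ x in {x | x ∈ Om z ∧ ‖dr z m g x‖ < 1},
        ENNReal.ofReal |1 - ‖dr z m g x‖ ^ 2| * ENNReal.ofReal (φ (HH z m g x)) := by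
    rw [← lintegral_indicator hO, ← lintegral_indicator hP.measurableSet]
    congr 1
    ext x
    by_cases hx : x ∈ Om z
    · by_cases hd : ‖dr z m g x‖ < 1
      · rw [Set.indicator_of_mem hx, Set.indicator_of_mem (by exact ⟨hx, hd⟩)]
        have : 0 ≤ 1 - ‖dr z m g x‖ ^ 2 := by nlinarith [norm_nonneg (dr z m g x)]
        rw [abs_of_nonneg this, ← ENNReal.ofReal_mul this, mul_comm]
      · rw [Set.indicator_of_mem hx, Set.indicator_of_notMem (by exact fun h => hd h.2)]
        have : 1 - ‖dr z m g x‖ ^ 2 ≤ 0 := by nlinarith [norm_nonneg (dr z m g x)]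
        exact ENNReal.ofReal_of_nonpos (mul_nonpos_of_nonneg_of_nonpos (hφ0 _) this)
    · rw [Set.indicator_of_notMem hx, Set.indicator_of_notMem (by exact fun h => hx h.1)]
  have eN : ∫⁻ x in Om z, ENNReal.ofReal (-(φ (HH z m g x) * (1 - ‖dr z m g x‖ ^ 2))) =
      ∫⁻ x in {x | x ∈ Om z ∧ 1 < ‖dr z m g x‖},
        ENNReal.ofReal |1 - ‖dr z m g x‖ ^ 2| * ENNReal.ofReal (φ (HH z m g x)) := by
    rw [← lintegral_indicator hO, ← lintegral_indicator hN.measurableSet]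
    congr 1
    ext x
    by_cases hx : x ∈ Om z
    · by_cases hd : 1 < ‖dr z m g x‖
      · rw [Set.indicator_of_mem hx, Set.indicator_of_mem (by exact ⟨hx, hd⟩)]
        have : 1 - ‖dr z m g x‖ ^ 2 ≤ 0 := by nlinarith [norm_nonneg (dr z m g x)]
        rw [abs_of_nonpos this, ← ENNReal.ofReal_mul (by linarith)]
        congr 1; ring
      · rw [Set.indicator_of_mem hx, Set.indicator_of_notMem (by exact fun h => hd h.2)]
        have : 0 ≤ 1 - ‖dr z m g x‖ ^ 2 := by nlinarith [norm_nonneg (dr z m g x)]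
        exact ENNReal.ofReal_of_nonpos (neg_nonpos.2 (mul_nonneg (hφ0 _) this))
    · rw [Set.indicator_of_notMem hx, Set.indicator_of_notMem (by exact fun h => hx h.1)]
  refine ⟨hIntg, ?_, ?_, ?_⟩
  · rw [← eP]; exact hIntg.lintegral_lt_top.ne
  · rw [← eN]
    have h2 : Integrable (fun x => -(φ (HH z m g x) * (1 - ‖dr z m g x‖ ^ 2)))
      (volume.restrict (Om z)) := Integrable.neg hIntg
    exact h2.lintegral_lt_top.ne
  · rw [← eP, ← eN]
    exact integral_eq_lintegral_pos_part_sub_lintegral_neg_part hIntg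

end KN
end

section
open Set Filter Topology Metric Complex MeasureTheory
namespace KN

theorem test_fn_one (a δ T : ℝ) (hδ : 0 < δ) (hT : 0 ≤ T) :
    ∃ β A : ℝ → ℝ, ContDiff ℝ 1 β ∧ (∀ s, 0 ≤ β s) ∧ (∀ s, β s ≠ 0 → |s - a| < δ) ∧ β a = 1 ∧
      ContDiff ℝ 1 A ∧ (∀ s, HasDerivAt A (β s - β (s - T)) s) ∧
      (∀ s, A s ≠ 0 → s ∈ Icc (a - δ) (a + T + δ)) := by
  let b : ContDiffBump a := ⟨δ / 2, δ, by positivity, by linarith⟩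
  have hbd : ContDiff ℝ 1 b := b.contDiff
  have hbc : Continuous b := hbd.continuous
  have hsupp : ∀ s, b s ≠ 0 → |s - a| < δ := by
    intro s hs
    have : s ∈ Function.support b := hs
    rw [b.support_eq] at this
    simpa [Real.dist_eq] using this
  let B : ℝ → ℝ := fun s => ∫ t in (0 : ℝ)..s, b t
  have hB : ∀ s, HasDerivAt B (b s) s := fun s =>
    intervalIntegral.integral_hasDerivAt_right (hbc.intervalIntegrable _ _)
      hbc.aestronglyMeasurable.stronglyMeasurableAtFilter hbc.continuousAt
  have hA : ∀ s, HasDerivAt (fun s => B s - B (s - T)) (b s - b (s - T)) s := fun s => by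
    have h2 : HasDerivAt (fun s => B (s - T)) (b (s - T)) s := by
      simpa using (hB (s - T)).comp_sub_const s T
    exact (hB s).sub h2
  refine ⟨b, fun s => B s - B (s - T), hbd, fun s => b.nonneg, hsupp, ?_, ?_, hA, ?_⟩
  · exact b.one_of_mem_closedBall (by simp [b]; positivity)
  · rw [contDiff_one_iff_deriv]
    refine ⟨fun s => (hA s).differentiableAt, ?_⟩
    have : deriv (fun s => B s - B (s - T)) = fun s => b s - b (s - T) := by
      ext s; exact (hA s).deriv
    rw [this]
    exact hbc.sub (hbc.comp (continuous_id.sub continuous_const))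
  · intro s hs
    by_contra hcon
    apply hs
    have e : B s - B (s - T) = ∫ t in (s - T)..s, b t :=
      intervalIntegral.integral_interval_sub_left (hbc.intervalIntegrable _ _) (hbc.intervalIntegrable _ _)
    show B s - B (s - T) = 0
    rw [e]
    apply intervalIntegral.integral_zero_ae
    refine Eventually.of_forall fun t ht => ?_
    rw [uIoc_of_le (by linarith)] at ht
    by_contra hb
    have h := abs_lt.1 (hsupp t hb)
    apply hcon
    constructor <;> linarith [ht.1, ht.2, h.1, h.2]

theorem test_fn (ζ0 : ℂ) (δ R : ℝ) (hδ : 0 < δ) :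
    ∃ φ0 φ1 ψ : ℂ → ℝ, (Continuous φ0 ∧ HasCompactSupport φ0 ∧ ∀ w, 0 ≤ φ0 w) ∧
      (Continuous φ1 ∧ HasCompactSupport φ1 ∧ ∀ w, 0 ≤ φ1 w) ∧
      ContDiff ℝ 1 ψ ∧ HasCompactSupport ψ ∧ (∀ w, fderiv ℝ ψ w 1 = φ0 w - φ1 w) ∧
      (∀ w, φ0 w ≠ 0 → w ∈ ball ζ0 δ) ∧ (∀ w, φ1 w ≠ 0 → R ≤ ‖w‖) ∧
      (∫⁻ w, ENNReal.ofReal (φ1 w)) = ∫⁻ w, ENNReal.ofReal (φ0 w) ∧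
      (∫⁻ w, ENNReal.ofReal (φ0 w)) ≠ 0 ∧ (∫⁻ w, ENNReal.ofReal (φ0 w)) ≠ ⊤ := by
  set T : ℝ := |R| + |ζ0.re| + δ with hT
  have hT0 : 0 ≤ T := by positivity
  obtain ⟨β, A, hβ, hβ0, hβs, hβ1, hA, hAd, hAs⟩ := test_fn_one ζ0.re (δ / 2) T (by positivity) hT0
  obtain ⟨κ, -, hκ, hκ0, hκs, hκ1, -, -, -⟩ := test_fn_one ζ0.im (δ / 2) T (by positivity) hT0
  have hre : ContDiff ℝ 1 (fun w : ℂ => w.re) := Complex.reCLM.contDiff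
  have him : ContDiff ℝ 1 (fun w : ℂ => w.im) := Complex.imCLM.contDiff
  have hβr : ContDiff ℝ 1 (fun w : ℂ => β w.re) := hβ.comp hre
  have hκi : ContDiff ℝ 1 (fun w : ℂ => κ w.im) := hκ.comp him
  have hcs : ∀ (f : ℂ → ℝ) (p q r s : ℝ), (∀ w, f w ≠ 0 → w.re ∈ Icc p q ∧ w.im ∈ Icc r s) →
      HasCompactSupport f := by
    intro f p q r s h
    refine HasCompactSupport.intro (K := Icc p q ×ℂ Icc r s)
      (isCompact_Icc.reProdIm isCompact_Icc) ?_
    intro w hw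
    by_contra hf
    exact hw (by rw [Complex.mem_reProdIm]; exact h w hf)
  have hc0 : Continuous (fun w : ℂ => β w.re * κ w.im) := (hβr.mul hκi).continuous
  have hs0 : HasCompactSupport (fun w : ℂ => β w.re * κ w.im) := by
    refine hcs _ (ζ0.re - δ/2) (ζ0.re + δ/2) (ζ0.im - δ/2) (ζ0.im + δ/2) fun w hw => ?_
    have h1 := abs_lt.1 (hβs _ (left_ne_zero_of_mul hw))
    have h2 := abs_lt.1 (hκs _ (right_ne_zero_of_mul hw))
    refine ⟨⟨?_, ?_⟩, ⟨?_, ?_⟩⟩ <;> linarith [h1.1, h1.2, h2.1, h2.2]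
  refine ⟨fun w => β w.re * κ w.im, fun w => β (w.re - T) * κ w.im, fun w => A w.re * κ w.im,
    ⟨hc0, hs0, fun w => mul_nonneg (hβ0 _) (hκ0 _)⟩,
    ⟨?_, ?_, fun w => mul_nonneg (hβ0 _) (hκ0 _)⟩, (hA.comp hre).mul hκi, ?_, ?_, ?_, ?_, ?_, ?_, ?_⟩
  · exact (hβ.continuous.comp (Complex.continuous_re.sub continuous_const)).mul hκi.continuous
  · refine hcs _ (ζ0.re + T - δ/2) (ζ0.re + T + δ/2) (ζ0.im - δ/2) (ζ0.im + δ/2) fun w hw => ?_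
    have h1 := abs_lt.1 (hβs _ (left_ne_zero_of_mul hw))
    have h2 := abs_lt.1 (hκs _ (right_ne_zero_of_mul hw))
    refine ⟨⟨?_, ?_⟩, ⟨?_, ?_⟩⟩ <;> linarith [h1.1, h1.2, h2.1, h2.2]
  · refine hcs _ (ζ0.re - δ/2) (ζ0.re + T + δ/2) (ζ0.im - δ/2) (ζ0.im + δ/2) fun w hw => ?_
    have h1 := hAs _ (left_ne_zero_of_mul hw)
    have h2 := abs_lt.1 (hκs _ (right_ne_zero_of_mul hw))
    exact ⟨h1, by constructor <;> linarith [h2.1, h2.2]⟩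
  · intro w
    have hl : HasDerivAt (fun t : ℝ => w + (t : ℂ) * 1) 1 0 := by
      have h1 : HasDerivAt (fun t : ℝ => (t : ℂ) * 1) 1 0 := by
        simpa using (hasDerivAt_id (0:ℝ)).ofReal_comp
      simpa using h1.const_add w
    have hd : DifferentiableAt ℝ (fun w : ℂ => A w.re * κ w.im) w :=
      (((hA.comp hre).mul hκi).differentiable (by norm_num)) w
    have hd' : HasFDerivAt (fun w : ℂ => A w.re * κ w.im)
      (fderiv ℝ (fun w : ℂ => A w.re * κ w.im) w) (w + ((0:ℝ):ℂ) * 1) := by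
      simpa using hd.hasFDerivAt
    have h1 := hd'.comp_hasDerivAt (0:ℝ) hl
    have h2 : HasDerivAt (fun t : ℝ => A (w.re + t) * κ w.im)
        ((β w.re - β (w.re - T)) * κ w.im) 0 := by
      have := (HasDerivAt.comp_const_add w.re 0 (by simpa using hAd w.re))
      exact this.mul_const _
    have e : ((fun w : ℂ => A w.re * κ w.im) ∘ fun t : ℝ => w + (t : ℂ) * 1)
        = fun t : ℝ => A (w.re + t) * κ w.im := by
      ext t; simp
    rw [e] at h1
    rw [h1.unique h2]; ring
  · intro w hw
    have h1 := hβs _ (left_ne_zero_of_mul hw)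
    have h2 := hκs _ (right_ne_zero_of_mul hw)
    rw [mem_ball, dist_eq_norm]
    have := Complex.norm_le_abs_re_add_abs_im (w - ζ0)
    simp only [sub_re, sub_im] at this
    linarith
  · intro w hw
    have h1 := abs_lt.1 (hβs _ (left_ne_zero_of_mul hw))
    have h3 := Complex.re_le_norm w
    linarith [le_abs_self R, neg_abs_le ζ0.re, h1.1]
  · have := lintegral_sub_right_eq_self (μ := (volume : Measure ℂ))
      (fun w : ℂ => ENNReal.ofReal (β w.re * κ w.im)) (T : ℂ)
    simpa using this
  · have : 0 < ∫⁻ w : ℂ, ENNReal.ofReal (β w.re * κ w.im) := by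
      have hc : Continuous (fun w : ℂ => ENNReal.ofReal (β w.re * κ w.im)) :=
        ENNReal.continuous_ofReal.comp hc0
      rw [lintegral_pos_iff_support hc.measurable]
      refine IsOpen.measure_pos _ hc.isOpen_support ⟨ζ0, ?_⟩
      simp [hβ1, hκ1]
    exact this.ne'
  · have hi := hc0.integrable_of_hasCompactSupport hs0 (μ := volume)
    have := hi.lintegral_lt_top
    exact this.ne

theorem disjoint_nhds {S : Finset ℂ} : ∃ V : ℂ → Set ℂ, (∀ x ∈ S, x ∈ V x ∧ IsOpen (V x)) ∧
    (S : Set ℂ).PairwiseDisjoint V := by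
  obtain ⟨V, hV, hd⟩ := S.finite_toSet.t2_separation
  exact ⟨V, fun x _ => hV x, hd⟩

theorem degree_bound {n : ℕ} (z : Fin n → ℂ) (hz : Function.Injective z) (m : Fin n → ℝ)
    (hm : ∀ j, 0 < m j) (g : ℂ) (hg : ‖g‖ ≠ 1) (Kp Kn : ℕ) (R : ℝ)
    (hKp : ∀ w, ∀ S : Finset ℂ, (∀ x ∈ S, (x ∈ Om z ∧ ‖dr z m g x‖ < 1) ∧ HH z m g x = w) → S.card ≤ Kp)
    (hKn : ∀ w, R ≤ ‖w‖ → ∀ S : Finset ℂ,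
      (∀ x ∈ S, (x ∈ Om z ∧ 1 < ‖dr z m g x‖) ∧ HH z m g x = w) → S.card ≤ Kn)
    (ζ0 : ℂ) (S : Finset ℂ) (hS : ∀ x ∈ S, (x ∈ Om z ∧ 1 < ‖dr z m g x‖) ∧ HH z m g x = ζ0) :
    S.card ≤ Kp + Kn := by
  have hNo : IsOpen {x | x ∈ Om z ∧ 1 < ‖dr z m g x‖} :=
    ((continuousOn_dr z m g).norm.isOpen_inter_preimage (isOpen_Om z) isOpen_Ioi)
  have hPo : IsOpen {x | x ∈ Om z ∧ ‖dr z m g x‖ < 1} :=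
    ((continuousOn_dr z m g).norm.isOpen_inter_preimage (isOpen_Om z) isOpen_Iio)
  obtain ⟨V, hV, hVd⟩ := disjoint_nhds (S := S)
  have hU : ∀ x : ℂ, ∃ U : Set ℂ, x ∈ S → IsOpen U ∧ x ∈ U ∧ InjOn (HH z m g) U := by
    intro x
    by_cases hx : x ∈ S
    · obtain ⟨U, h⟩ := HH_inj_nhds z m g (hS x hx).1.1 (hS x hx).1.2.ne'
      exact ⟨U, fun _ => h⟩
    · exact ⟨∅, fun h => absurd h hx⟩
  choose U hU using hU
  set W : ℂ → Set ℂ := fun x => U x ∩ V x ∩ {x | x ∈ Om z ∧ 1 < ‖dr z m g x‖} with hW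
  have hWo : ∀ x ∈ S, IsOpen (W x) := fun x hx => ((hU x hx).1.inter (hV x hx).2).inter hNo
  have hWm : ∀ x ∈ S, x ∈ W x := fun x hx => ⟨⟨(hU x hx).2.1, (hV x hx).1⟩, (hS x hx).1⟩
  have himg : ∀ x ∈ S, HH z m g '' W x ∈ 𝓝 ζ0 := by
    intro x hx
    have h := HH_open z m g (hS x hx).1.1 (hS x hx).1.2.ne'
    rw [(hS x hx).2] at h
    rw [← h]
    exact image_mem_map ((hWo x hx).mem_nhds (hWm x hx))
  have hall : (⋂ x ∈ S, HH z m g '' W x) ∈ 𝓝 ζ0 := (Filter.biInter_finset_mem S).2 himg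
  obtain ⟨δ, hδ, hball⟩ := Metric.mem_nhds_iff.1 hall
  obtain ⟨φ0, φ1, ψ, ⟨h0c, h0s, h00⟩, ⟨h1c, h1s, h10⟩, hψ, hψs, hψd, hb0, hb1, hIntg, hne0, hnet⟩ :=
    test_fn ζ0 δ R hδ
  obtain ⟨i0, p0, n0, e0⟩ := split_int z hz m hm g hg φ0 h0c h0s h00
  obtain ⟨i1, p1, n1, e1⟩ := split_int z hz m hm g hg φ1 h1c h1s h10
  have hdeg := degree_identity z hz m hm g hg ψ hψ hψs
  have hdeg' : ∫ x in Om z, (φ0 (HH z m g x) * (1 - ‖dr z m g x‖ ^ 2)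
      - φ1 (HH z m g x) * (1 - ‖dr z m g x‖ ^ 2)) = 0 := by
    rw [← hdeg]
    congr 1; ext x; rw [hψd]; ring
  rw [integral_sub i0 i1, e0, e1] at hdeg'
  have u0 := area_upper z m g {x | x ∈ Om z ∧ ‖dr z m g x‖ < 1} hPo.measurableSet
    (fun x hx => ⟨hx.1, hx.2.ne⟩) (fun w => ENNReal.ofReal (φ0 w))
    (ENNReal.continuous_ofReal.comp h0c).measurable Kp (fun w _ => hKp w)
  have u1 := area_upper z m g {x | x ∈ Om z ∧ 1 < ‖dr z m g x‖} hNo.measurableSet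
    (fun x hx => ⟨hx.1, hx.2.ne'⟩) (fun w => ENNReal.ofReal (φ1 w))
    (ENNReal.continuous_ofReal.comp h1c).measurable Kn
    (fun w hw => hKn w (hb1 w (fun h => hw (by simp [h]))))
  have l0 := area_lower z m g {x | x ∈ Om z ∧ 1 < ‖dr z m g x‖} (fun x hx => hx.1)
    (fun w => ENNReal.ofReal (φ0 w)) S W hWo (fun x hx => inter_subset_right)
    (hVd.mono_on (fun x hx y hy => hy.1.2))
    (fun x hx => (hU x hx).2.2.mono (fun y hy => hy.1.1))
    (fun x hx w hw => by
      have := hball (hb0 w (fun h => hw (by simp [h])))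
      exact mem_iInter₂.1 this x hx)
  rw [hIntg] at u1
  set c := ∫⁻ w, ENNReal.ofReal (φ0 w) with hc
  have hcpos : 0 < c.toReal := ENNReal.toReal_pos hne0 hnet
  have u0' := ENNReal.toReal_mono (ENNReal.mul_ne_top (by simp) hnet) u0
  have u1' := ENNReal.toReal_mono (ENNReal.mul_ne_top (by simp) hnet) u1
  have l0' := ENNReal.toReal_mono n0 l0
  rw [ENNReal.toReal_mul] at u0' u1' l0'
  simp only [ENNReal.toReal_natCast] at u0' u1' l0'
  have hp1 : 0 ≤ (∫⁻ x in {x | x ∈ Om z ∧ ‖dr z m g x‖ < 1},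
    ENNReal.ofReal |1 - ‖dr z m g x‖ ^ 2| * ENNReal.ofReal (φ1 (HH z m g x))).toReal :=
    ENNReal.toReal_nonneg
  have : (S.card : ℝ) * c.toReal ≤ (Kp + Kn) * c.toReal := by linarith
  have := le_of_mul_le_mul_right this hcpos
  exact_mod_cast this

end KN
end

section
open Set Filter Topology Metric Complex MeasureTheory
namespace KN

theorem pole_inj {n : ℕ} (z : Fin n → ℂ) (hz : Function.Injective z) (m : Fin n → ℝ)
    (hm : ∀ j, 0 < m j) (g : ℂ) (j : Fin n) :
    ∃ ρ > 0, InjOn (HH z m g) (ball (z j) ρ \ {z j}) := by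
  set P : ℂ → ℂ := fun x => (x - (starRingEnd ℂ) (g * x)) -
    (starRingEnd ℂ) (∑ k ∈ Finset.univ.erase j, (m k : ℂ) / (x - z k)) with hP
  have hHP : ∀ x, HH z m g x = P x - (starRingEnd ℂ) ((m j : ℂ) / (x - z j)) := by
    intro x
    rw [HH_formula, ← Finset.add_sum_erase _ _ (Finset.mem_univ j), map_add, hP]
    ring
  have hconj : ContDiff ℝ 1 (fun x : ℂ => (starRingEnd ℂ) x) := Complex.conjCLE.contDiff
  have hPd : ContDiffAt ℝ 1 P (z j) := by
    refine ContDiffAt.sub (ContDiffAt.sub contDiffAt_id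
      (hconj.contDiffAt.comp _ (contDiffAt_const.mul contDiffAt_id)))
      (hconj.contDiffAt.comp _ ?_)
    suffices hc : ContDiffAt ℂ 1
        (fun x : ℂ => ∑ k ∈ Finset.univ.erase j, (m k : ℂ) / (x - z k)) (z j) by
      exact hc.restrict_scalars ℝ
    refine ContDiffAt.sum fun k hk => ?_
    refine ContDiffAt.div contDiffAt_const (contDiffAt_id.sub contDiffAt_const) ?_
    exact sub_ne_zero.2 (fun h => (Finset.ne_of_mem_erase hk) (hz h).symm)
  obtain ⟨K, s, hs, hL⟩ := hPd.exists_lipschitzOnWith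
  obtain ⟨ρ0, hρ0, hb⟩ := Metric.mem_nhds_iff.1 hs
  have hm' := hm j
  have hev : ∀ᶠ ρ : ℝ in 𝓝[>] 0, (K : ℝ) * (ρ * ρ) < m j := by
    have : ContinuousAt (fun ρ : ℝ => (K : ℝ) * (ρ * ρ)) 0 := by fun_prop
    have h := this.tendsto.eventually_lt_const (u := m j) (by simpa using hm')
    exact h.filter_mono nhdsWithin_le_nhds
  have hev2 : ∀ᶠ ρ : ℝ in 𝓝[>] 0, ρ < ρ0 :=
    (eventually_lt_nhds hρ0).filter_mono nhdsWithin_le_nhds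
  obtain ⟨ρ, ⟨h1, h2⟩, h3⟩ := ((hev.and hev2).and self_mem_nhdsWithin).exists
  refine ⟨ρ, h3, ?_⟩
  rintro u ⟨hu, hu'⟩ v ⟨hv, hv'⟩ huv
  by_contra hne
  have hu0 : u - z j ≠ 0 := sub_ne_zero.2 hu'
  have hv0 : v - z j ≠ 0 := sub_ne_zero.2 hv'
  rw [hHP, hHP] at huv
  have e : P u - P v = (starRingEnd ℂ) ((m j : ℂ) * (v - u) / ((u - z j) * (v - z j))) := by
    have : (m j : ℂ) * (v - u) / ((u - z j) * (v - z j))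
      = (m j : ℂ) / (u - z j) - (m j : ℂ) / (v - z j) := by
      field_simp; ring
    rw [this, map_sub]
    linear_combination huv
  have hl := hL.dist_le_mul u (hb (ball_subset_ball h2.le hu)) v (hb (ball_subset_ball h2.le hv))
  rw [dist_eq_norm, e, Complex.norm_conj, norm_div, norm_mul, norm_mul, Complex.norm_real,
    Real.norm_of_nonneg hm'.le, dist_eq_norm, norm_sub_rev v u] at hl
  have hd : 0 < ‖u - v‖ := norm_pos_iff.2 (sub_ne_zero.2 hne)
  have hp : 0 < ‖u - z j‖ * ‖v - z j‖ := by positivity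
  rw [div_le_iff₀ hp] at hl
  have hl' : m j ≤ K * (‖u - z j‖ * ‖v - z j‖) := by
    refine le_of_mul_le_mul_right ?_ hd
    linarith
  rw [mem_ball, dist_eq_norm] at hu hv
  have : ‖u - z j‖ * ‖v - z j‖ ≤ ρ * ρ := by gcongr
  have := mul_le_mul_of_nonneg_left this K.2
  simp only [NNReal.val_eq_coe] at this
  linarith

theorem inf_inj {n : ℕ} (z : Fin n → ℂ) (m : Fin n → ℝ)
    (hm : ∀ j, 0 < m j) (g : ℂ) (hg : 1 < ‖g‖) :
    ∃ R, InjOn (HH z m g) {x | R ≤ ‖x‖} := by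
  set M := ∑ j, m j with hM
  have hM0 : 0 ≤ M := Finset.sum_nonneg fun j _ => (hm j).le
  have hev : ∀ᶠ ε : ℝ in 𝓝[>] 0, M * (ε * ε) < ‖g‖ - 1 := by
    have : ContinuousAt (fun ρ : ℝ => M * (ρ * ρ)) 0 := by fun_prop
    have h := this.tendsto.eventually_lt_const (u := ‖g‖ - 1) (by simpa using hg)
    exact h.filter_mono nhdsWithin_le_nhds
  obtain ⟨ε, hε, hε0⟩ := (hev.and self_mem_nhdsWithin).exists
  have hε0 : 0 < ε := hε0
  have h1 : ∀ᶠ x in cocompact ℂ, (∀ j, ‖(x - z j)⁻¹‖ < ε) ∧ x ∈ Om z := by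
    refine Filter.Eventually.and ?_ (ev_Om z)
    rw [eventually_all]
    intro j
    exact (tendsto_inv_sub_cocompact (z j)).norm.eventually_lt_const (by simpa using hε0)
  obtain ⟨R, hR⟩ := exists_radius h1
  refine ⟨R, ?_⟩
  intro u hu v hv huv
  by_contra hne
  obtain ⟨hu1, hu2⟩ := hR u hu
  obtain ⟨hv1, hv2⟩ := hR v hv
  rw [HH_formula, HH_formula] at huv
  have e : LL g (u - v) = (starRingEnd ℂ) (∑ j, (m j : ℂ) * (v - u) * ((u - z j)⁻¹ * (v - z j)⁻¹)) := by
    have : ∑ j, (m j : ℂ) * (v - u) * ((u - z j)⁻¹ * (v - z j)⁻¹)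
      = ∑ j, (m j : ℂ) / (u - z j) - ∑ j, (m j : ℂ) / (v - z j) := by
      rw [← Finset.sum_sub_distrib]
      refine Finset.sum_congr rfl fun j _ => ?_
      have := sub_ne_zero.2 (hu2 j)
      have := sub_ne_zero.2 (hv2 j)
      field_simp; ring
    rw [LL_apply, mul_sub, map_sub, this, map_sub]
    linear_combination huv
  have hl := LL_lower g (u - v)
  rw [e, Complex.norm_conj, abs_sub_comm, abs_of_pos (by linarith)] at hl
  have hs : ‖∑ j, (m j : ℂ) * (v - u) * ((u - z j)⁻¹ * (v - z j)⁻¹)‖ ≤ M * (ε * ε) * ‖u - v‖ := by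
    refine (norm_sum_le _ _).trans ?_
    rw [hM, Finset.sum_mul, Finset.sum_mul]
    refine Finset.sum_le_sum fun j _ => ?_
    rw [norm_mul, norm_mul, norm_mul, Complex.norm_real, Real.norm_of_nonneg (hm j).le,
      norm_sub_rev v u]
    have h1 := (hu1 j).le
    have h2 := (hv1 j).le
    have h3 := (hm j).le
    calc m j * ‖u - v‖ * (‖(u - z j)⁻¹‖ * ‖(v - z j)⁻¹‖) ≤ m j * ‖u - v‖ * (ε * ε) := by gcongr
      _ = _ := by ring
  have hd : 0 < ‖u - v‖ := norm_pos_iff.2 (sub_ne_zero.2 hne)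
  have := mul_lt_mul_of_pos_right hε hd
  linarith

theorem cover_count {ι : Type*} [Fintype ι] (H : ℂ → ℂ) (E : ι → Set ℂ)
    (hE : ∀ i, InjOn H (E i)) (S : Finset ℂ) (w : ℂ) (hS : ∀ x ∈ S, H x = w ∧ ∃ i, x ∈ E i) :
    S.card ≤ Fintype.card ι := by
  classical
  have : ∀ x : S, ∃ i, (x : ℂ) ∈ E i := fun x => (hS x x.2).2
  choose f hf using this
  have hinj : Function.Injective f := by
    intro x y hxy
    refine Subtype.ext (hE (f x) (hf x) (hxy ▸ hf y) ?_)
    rw [(hS x x.2).1, (hS y y.2).1]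
  simpa using Fintype.card_le_of_injective f hinj

theorem bdd_away {n : ℕ} (z : Fin n → ℂ) (m : Fin n → ℝ) (g : ℂ) (ρ : Fin n → ℝ)
    (hρ : ∀ j, 0 < ρ j) (R0 : ℝ) :
    ∃ R, ∀ x ∈ Om z, R ≤ ‖HH z m g x‖ → (∃ j, x ∈ ball (z j) (ρ j) \ {z j}) ∨ R0 ≤ ‖x‖ := by
  set C : Set ℂ := closedBall 0 R0 \ ⋃ j, ball (z j) (ρ j) with hC
  have hCc : IsCompact C := (isCompact_closedBall _ _).diff (isOpen_iUnion fun j => isOpen_ball)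
  have hCO : C ⊆ Om z := by
    intro x hx j hj
    exact hx.2 (mem_iUnion.2 ⟨j, by rw [hj]; exact mem_ball_self (hρ j)⟩)
  obtain ⟨B, hB⟩ := hCc.exists_bound_of_continuousOn ((continuousOn_HH z m g).mono hCO)
  refine ⟨B + 1, fun x hx hxR => ?_⟩
  by_contra hcon
  push Not at hcon
  have : x ∈ C := by
    refine ⟨by simpa using hcon.2.le, fun h => ?_⟩
    obtain ⟨j, hj⟩ := mem_iUnion.1 h
    exact hcon.1 j ⟨hj, hx j⟩
  linarith [hB x this]

theorem far_count_lt {n : ℕ} (z : Fin n → ℂ) (hz : Function.Injective z) (m : Fin n → ℝ)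
    (hm : ∀ j, 0 < m j) (g : ℂ) (hg : ‖g‖ < 1) :
    ∃ R : ℝ, ∀ w, R ≤ ‖w‖ → ∀ S : Finset ℂ,
      (∀ x ∈ S, (x ∈ Om z ∧ 1 < ‖dr z m g x‖) ∧ HH z m g x = w) → S.card ≤ n := by
  choose ρ hρ hi using pole_inj z hz m hm g
  obtain ⟨R0, hR0⟩ := exists_radius ((tendsto_dr_cocompact z m g).norm.eventually_lt_const hg)
  obtain ⟨R, hR⟩ := bdd_away z m g ρ hρ R0
  refine ⟨R, fun w hw S hS => ?_⟩
  have := cover_count (HH z m g) (fun j => ball (z j) (ρ j) \ {z j}) hi S w (fun x hx => by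
    obtain ⟨⟨h1, h2⟩, h3⟩ := hS x hx
    refine ⟨h3, ?_⟩
    rcases hR x h1 (by rw [h3]; exact hw) with h | h
    · exact h
    · linarith [hR0 x h])
  simpa using this

theorem far_count_gt {n : ℕ} (z : Fin n → ℂ) (hz : Function.Injective z) (m : Fin n → ℝ)
    (hm : ∀ j, 0 < m j) (g : ℂ) (hg : 1 < ‖g‖) :
    ∃ R : ℝ, ∀ w, R ≤ ‖w‖ → ∀ S : Finset ℂ,
      (∀ x ∈ S, (x ∈ Om z ∧ 1 < ‖dr z m g x‖) ∧ HH z m g x = w) → S.card ≤ n + 1 := by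
  choose ρ hρ hi using pole_inj z hz m hm g
  obtain ⟨R0, hR0⟩ := inf_inj z m hm g hg
  obtain ⟨R, hR⟩ := bdd_away z m g ρ hρ R0
  refine ⟨R, fun w hw S hS => ?_⟩
  have := cover_count (ι := Option (Fin n)) (HH z m g)
    (fun o => o.elim {x | R0 ≤ ‖x‖} (fun j => ball (z j) (ρ j) \ {z j}))
    (fun o => by cases o with
      | none => exact hR0
      | some j => exact hi j) S w (fun x hx => by
    obtain ⟨⟨h1, h2⟩, h3⟩ := hS x hx
    refine ⟨h3, ?_⟩
    rcases hR x h1 (by rw [h3]; exact hw) with ⟨j, h⟩ | h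
    · exact ⟨some j, h⟩
    · exact ⟨none, h⟩)
  simpa using this

end KN
end

section
open Set Filter Topology Metric Complex MeasureTheory
namespace KN

theorem repel_ne {n : ℕ} (hn : 2 ≤ n) (z : Fin n → ℂ) (hz : Function.Injective z) (m : Fin n → ℝ)
    (hm : ∀ j, 0 < m j) (g : ℂ) (hg0 : g ≠ 0) (hg : ‖g‖ ≠ 1) (w : ℂ) (S : Finset ℂ)
    (hS : ∀ x ∈ S, (x ∈ Om z ∧ 1 < ‖dr z m g x‖) ∧ HH z m g x = w) : S.card ≤ 3 * n := by
  have hA : ∀ w, ∀ S : Finset ℂ,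
      (∀ x ∈ S, (x ∈ Om z ∧ ‖dr z m g x‖ < 1) ∧ HH z m g x = w) →
      S.card ≤ 2 * n ∧ (1 < ‖g‖ → S.card + 1 ≤ 2 * n) := by
    intro w S hS
    refine partA hn z hz m hm g ((starRingEnd ℂ) w) hg0 S fun x hx => ?_
    obtain ⟨⟨h1, h2⟩, h3⟩ := hS x hx
    exact ⟨h1, (fix_iff z m g _ x).2 (by simp [h3]), h2.le⟩
  rcases lt_or_gt_of_ne hg with h | h
  · obtain ⟨R, hR⟩ := far_count_lt z hz m hm g h
    have := degree_bound z hz m hm g hg (2 * n) n R (fun w S hS => (hA w S hS).1) hR w S hS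
    omega
  · obtain ⟨R, hR⟩ := far_count_gt z hz m hm g h
    have := degree_bound z hz m hm g hg (2 * n - 1) (n + 1) R
      (fun w S hS => by have := (hA w S hS).2 h; omega) hR w S hS
    omega

theorem dr_shift {n : ℕ} (z : Fin n → ℂ) (m : Fin n → ℝ) (g a x : ℂ) :
    dr z m a x = dr z m g x + (a - g) := by
  simp only [dr]; ring

theorem HH_shift {n : ℕ} (z : Fin n → ℂ) (m : Fin n → ℝ) (g a x : ℂ) :
    HH z m a x = HH z m g x - (starRingEnd ℂ) ((a - g) * x) := by
  simp only [HH_formula, sub_mul, map_sub]; ring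

theorem persist {n : ℕ} (z : Fin n → ℂ) (m : Fin n → ℝ) (g x w : ℂ) (hx : x ∈ Om z)
    (hd : 1 < ‖dr z m g x‖) (hw : HH z m g x = w) (U : Set ℂ) (hU : U ∈ 𝓝 x) :
    ∀ᶠ a in 𝓝 g, ∃ y ∈ U, (y ∈ Om z ∧ 1 < ‖dr z m a y‖) ∧ HH z m a y = w := by
  set G : ℂ × ℂ → ℂ × ℂ := fun p => (p.1, HH z m g p.2 - (starRingEnd ℂ) ((p.1 - g) * p.2)) with hG
  have hp1 : HasStrictFDerivAt (fun p : ℂ × ℂ => p.1 - g) (ContinuousLinearMap.fst ℝ ℂ ℂ) (g, x) :=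
    (hasStrictFDerivAt_fst (𝕜 := ℝ) (p := ((g, x) : ℂ × ℂ))).sub_const g
  have hp2 : HasStrictFDerivAt (fun p : ℂ × ℂ => p.2) (ContinuousLinearMap.snd ℝ ℂ ℂ) (g, x) :=
    hasStrictFDerivAt_snd
  have hmul : HasStrictFDerivAt (fun p : ℂ × ℂ => (p.1 - g) * p.2)
      ((g - g) • ContinuousLinearMap.snd ℝ ℂ ℂ + x • ContinuousLinearMap.fst ℝ ℂ ℂ) (g, x) :=
    hp1.mul' hp2 |>.congr_fderiv (by ext <;> simp)
  have hconj := ((Complex.conjCLE : ℂ →L[ℝ] ℂ).hasStrictFDerivAt (x := (g - g) * x)).comp (g, x) hmul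
  have hH : HasStrictFDerivAt (fun p : ℂ × ℂ => HH z m g p.2)
      ((LL (dr z m g x)).comp (ContinuousLinearMap.snd ℝ ℂ ℂ)) (g, x) :=
    HasStrictFDerivAt.comp (g := HH z m g) (g, x) (hasStrictFDerivAt_HH z m g hx) hasStrictFDerivAt_snd
  have hGd := (hasStrictFDerivAt_fst (𝕜 := ℝ) (p := ((g, x) : ℂ × ℂ))).prodMk (hH.sub hconj)
  have hGd' : HasStrictFDerivAt G _ (g, x) := hGd
  have hmap := hGd'.map_nhds_eq_of_surj (by
    rw [LinearMap.range_eq_top]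
    rintro ⟨a, b⟩
    have hs : Function.Surjective (LL (dr z m g x)) := LinearMap.range_eq_top.1 (LL_range _ hd.ne')
    obtain ⟨h, hh⟩ := hs (b + (starRingEnd ℂ) (x * a))
    refine ⟨(a, h), ?_⟩
    simp [hh])
  have hGx : G (g, x) = (g, w) := by simp [hG, hw]
  rw [hGx] at hmap
  have hset : {p : ℂ × ℂ | p.2 ∈ U ∧ p.2 ∈ Om z ∧ 1 < ‖dr z m g p.2 + (p.1 - g)‖} ∈ 𝓝 (g, x) := by
    have h1 : ∀ᶠ p : ℂ × ℂ in 𝓝 (g, x), p.2 ∈ U := continuousAt_snd.eventually hU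
    have h2 : ∀ᶠ p : ℂ × ℂ in 𝓝 (g, x), p.2 ∈ Om z :=
      continuousAt_snd.eventually ((isOpen_Om z).mem_nhds hx)
    have hc : ContinuousAt (dr z m g) x := (continuousOn_dr z m g).continuousAt ((isOpen_Om z).mem_nhds hx)
    have hc2 : ContinuousAt (fun p : ℂ × ℂ => ‖dr z m g p.2 + (p.1 - g)‖) (g, x) := by
      have : ContinuousAt (fun p : ℂ × ℂ => dr z m g p.2) (g, x) :=
        ContinuousAt.comp (g := dr z m g) (f := Prod.snd) hc continuousAt_snd
      exact (this.add (continuousAt_fst.sub continuousAt_const)).norm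
    have h3 : ∀ᶠ p : ℂ × ℂ in 𝓝 (g, x), 1 < ‖dr z m g p.2 + (p.1 - g)‖ :=
      hc2.tendsto.eventually_const_lt (by simpa using hd)
    filter_upwards [h1, h2, h3] with p a b c using ⟨a, b, c⟩
  have himg := image_mem_map (m := G) hset
  rw [hmap] at himg
  have hcont : ContinuousAt (fun a : ℂ => (a, w)) g := by fun_prop
  filter_upwards [hcont.eventually himg] with a ha
  obtain ⟨⟨a', y⟩, ⟨h1, h2, h3⟩, h4⟩ := ha
  simp only [hG, Prod.mk.injEq] at h4
  obtain ⟨rfl, h5⟩ := h4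
  exact ⟨y, h1, ⟨h2, by rw [dr_shift z m g]; exact h3⟩, by rw [HH_shift z m g]; exact h5⟩

theorem repel {n : ℕ} (hn : 2 ≤ n) (z : Fin n → ℂ) (hz : Function.Injective z) (m : Fin n → ℝ)
    (hm : ∀ j, 0 < m j) (g : ℂ) (hg0 : g ≠ 0) (w : ℂ) (S : Finset ℂ)
    (hS : ∀ x ∈ S, (x ∈ Om z ∧ 1 < ‖dr z m g x‖) ∧ HH z m g x = w) : S.card ≤ 3 * n := by
  classical
  by_cases hg : ‖g‖ = 1
  swap
  · exact repel_ne hn z hz m hm g hg0 hg w S hS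
  obtain ⟨V, hV, hVd⟩ := disjoint_nhds (S := S)
  have hall : ∀ᶠ a in 𝓝 g, ∀ x ∈ S, ∃ y ∈ V x, (y ∈ Om z ∧ 1 < ‖dr z m a y‖) ∧ HH z m a y = w := by
    rw [Filter.eventually_all_finset]
    intro x hx
    exact persist z m g x w (hS x hx).1.1 (hS x hx).1.2 (hS x hx).2 _ ((hV x hx).2.mem_nhds (hV x hx).1)
  have hcont : ContinuousAt (fun t : ℝ => ((1 - t : ℝ) : ℂ) * g) 0 := by fun_prop
  have hall' : ∀ᶠ t : ℝ in 𝓝[>] 0, ∀ x ∈ S, ∃ y ∈ V x,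
      (y ∈ Om z ∧ 1 < ‖dr z m (((1 - t : ℝ) : ℂ) * g) y‖) ∧ HH z m (((1 - t : ℝ) : ℂ) * g) y = w :=
    (Tendsto.eventually (by simpa [ContinuousAt] using hcont) hall).filter_mono nhdsWithin_le_nhds
  have h1 : ∀ᶠ t : ℝ in 𝓝[>] 0, t < 1 :=
    (eventually_lt_nhds (by norm_num)).filter_mono nhdsWithin_le_nhds
  obtain ⟨t, ⟨ht, ht1⟩, ht0⟩ := ((hall'.and h1).and self_mem_nhdsWithin).exists
  have ht0 : 0 < t := ht0
  set a : ℂ := ((1 - t : ℝ) : ℂ) * g with ha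
  have hna : ‖a‖ = 1 - t := by
    rw [ha, norm_mul, Complex.norm_real, hg, mul_one, Real.norm_of_nonneg (by linarith)]
  have ha0 : a ≠ 0 := by
    rw [← norm_pos_iff, hna]; linarith
  have hex : ∀ x : ℂ, ∃ y, x ∈ S → y ∈ V x ∧ (y ∈ Om z ∧ 1 < ‖dr z m a y‖) ∧ HH z m a y = w := by
    intro x
    by_cases hx : x ∈ S
    · obtain ⟨y, h⟩ := ht x hx
      exact ⟨y, fun _ => h⟩
    · exact ⟨0, fun h => absurd h hx⟩
  choose y hy using hex
  have hinj : InjOn y S := by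
    intro u hu v hv huv
    by_contra hne
    exact Set.disjoint_left.1 (hVd hu hv hne) (hy u hu).1 (huv ▸ (hy v hv).1)
  have := repel_ne hn z hz m hm a ha0 (by rw [hna]; linarith) w (S.image y) (by
    intro x hx
    obtain ⟨u, hu, rfl⟩ := Finset.mem_image.1 hx
    exact (hy u hu).2)
  rwa [Finset.card_image_of_injOn hinj] at this

end KN
end

/-- Khavinson–Neumann, nonzero shear: a point lens on `n ≥ 2`
masses with nonzero external shear produces at most `5n` images of any
source `ζ`. -/
theorem khavinson_neumann_nonzero_shear
    (n : ℕ) (hn : 2 ≤ n)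
    (z : Fin n → ℂ) (hz : Function.Injective z)
    (m : Fin n → ℝ) (hm : ∀ j, 0 < m j)
    (γ : ℂ) (hγ : γ ≠ 0)
    (η : ℂ → ℂ)
    (hη : ∀ x : ℂ, η x =
      x - γ * (starRingEnd ℂ) x
        - ∑ j, (m j : ℂ) / ((starRingEnd ℂ) x - (starRingEnd ℂ) (z j)))
    (ζ : ℂ) :
    {x : ℂ | (∀ j, x ≠ z j) ∧ η x = ζ}.Finite ∧
      {x : ℂ | (∀ j, x ≠ z j) ∧ η x = ζ}.ncard ≤ 5 * n := by
  classical
  have hH : ∀ x, KN.HH z m ((starRingEnd ℂ) γ) x = η x := by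
    intro x
    rw [KN.HH_formula, hη]
    simp
  have hγ' : (starRingEnd ℂ) γ ≠ 0 := by simpa using hγ
  have key : ∀ S : Finset ℂ, (S : Set ℂ) ⊆ {x : ℂ | (∀ j, x ≠ z j) ∧ η x = ζ} → S.card ≤ 5 * n := by
    intro S hS
    have h1 := (KN.partA hn z hz m hm _ ((starRingEnd ℂ) ζ) hγ'
      (S.filter fun x => ‖KN.dr z m ((starRingEnd ℂ) γ) x‖ ≤ 1) (by
        intro x hx
        rw [Finset.mem_filter] at hx
        have := hS hx.1
        exact ⟨this.1, (KN.fix_iff z m _ _ x).2 (by rw [hH, this.2]; simp), hx.2⟩)).1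
    have h2 := KN.repel hn z hz m hm _ hγ' ζ
      (S.filter fun x => ¬ ‖KN.dr z m ((starRingEnd ℂ) γ) x‖ ≤ 1) (by
        intro x hx
        rw [Finset.mem_filter] at hx
        have := hS hx.1
        exact ⟨⟨this.1, not_le.1 hx.2⟩, by rw [hH, this.2]⟩)
    have h3 := Finset.card_filter_add_card_filter_not (s := S)
      (fun x => ‖KN.dr z m ((starRingEnd ℂ) γ) x‖ ≤ 1)
    omega
  have hfin : {x : ℂ | (∀ j, x ≠ z j) ∧ η x = ζ}.Finite := by
    by_contra hinf
    obtain ⟨T, hT, hc⟩ := Set.Infinite.exists_subset_card_eq hinf (5 * n + 1)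
    have := key T hT
    omega
  refine ⟨hfin, ?_⟩
  rw [Set.ncard_eq_toFinset_card _ hfin]
  exact key _ (by simp)
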